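/- arXiv:2303.14629 — 2 statements merged into one kernel-verified Lean document; each statement's English description precedes it below -/
import Mathlib

section
/- Let d ≥ 1 be an integer and c₁, c₂ > 0 real constants. Let m, n : ℕ → ℕ be sequences of positive integers with m(N) ≤ n(N) for all large N, m(N) = c₁ N^d + O(N^{d−1}) and n(N) = c₂ N^d + O(N^{d−1}) as N → ∞. Then the average entanglement entropy ⟨E_N⟩ = ∫_{S} E(v) dμ_N(v), where μ_N is the uniform probability measure on the unit sphere of ℂ^{m(N)} ⊗ ℂ^{n(N)}, satisfies ⟨E_N⟩ = d·ln N + ln c₁ − c₁/(2c₂) + O(1/N) as N → ∞. -/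
open MeasureTheory Matrix

noncomputable section

instance (ι : Type*) [Fintype ι] : MeasurableSpace (EuclideanSpace ℂ ι) := borel _
instance (ι : Type*) [Fintype ι] : BorelSpace (EuclideanSpace ℂ ι) := ⟨rfl⟩
instance (ι : Type*) [Fintype ι] : InnerProductSpace ℝ (EuclideanSpace ℂ ι) :=
  InnerProductSpace.rclikeToReal ℂ _

/-- The model for `ℂ^m ⊗ ℂ^n`: a Euclidean space indexed by `Fin m × Fin n`,
so that a vector is identified with the matrix of its coefficients in the
fixed (standard) orthonormal bases. -/
abbrev TensorSp (m n : ℕ) := EuclideanSpace ℂ (Fin m × Fin n)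

/-- The coefficient matrix `A(v)` of `v ∈ ℂ^m ⊗ ℂ^n`. -/
def coeffMatrix {m n : ℕ} (v : TensorSp m n) : Matrix (Fin m) (Fin n) ℂ :=
  Matrix.of fun j k => v (j, k)

/-- The reduced density matrix `ρ(v) = A(v) A(v)*`. -/
def redDensity {m n : ℕ} (v : TensorSp m n) : Matrix (Fin m) (Fin m) ℂ :=
  coeffMatrix v * (coeffMatrix v)ᴴ

theorem redDensity_isHermitian {m n : ℕ} (v : TensorSp m n) :
    (redDensity v).IsHermitian :=
  Matrix.isHermitian_mul_conjTranspose_self _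

/-- The eigenvalues `p_1(v), …, p_m(v)` of the reduced density matrix
(the squares of the Schmidt coefficients of `v`). -/
def schmidtSq {m n : ℕ} (v : TensorSp m n) : Fin m → ℝ :=
  (redDensity_isHermitian v).eigenvalues

/-- The entanglement entropy `E(v) = -∑ p_j ln p_j` (recall `Real.log 0 = 0`,
which implements the convention `0 · ln 0 = 0`). -/
def entEntropy {m n : ℕ} (v : TensorSp m n) : ℝ :=
  -∑ j, schmidtSq v j * Real.log (schmidtSq v j)

/-- The uniform (rotation-invariant) probability measure on the unit sphere
`S^{2mn-1}` of `ℂ^m ⊗ ℂ^n`: the normalization of the measure induced on the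
sphere by the Lebesgue (Haar) measure of the ambient Euclidean space. -/
def sphereUniform (m n : ℕ) : Measure (Metric.sphere (0 : TensorSp m n) 1) :=
  ((volume : Measure (TensorSp m n)).toSphere Set.univ)⁻¹ •
    (volume : Measure (TensorSp m n)).toSphere

open Asymptotics Filter

section GaussianProb

variable {E : Type*} [NormedAddCommGroup E] [NormedSpace ℝ E] [FiniteDimensional ℝ E]
  [MeasurableSpace E] [BorelSpace E] [Nontrivial E] (μ : Measure E) [μ.IsAddHaarMeasure]

theorem integrable_one_add_norm_pow_mul_exp (k : ℕ) :
    Integrable (fun v : E => (1 + ‖v‖) ^ k * Real.exp (-‖v‖ ^ 2)) μ := by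
  have hpow : ∀ j : ℕ, Integrable (fun v : E => ‖v‖ ^ j * Real.exp (-‖v‖ ^ 2)) μ := by
    intro j
    refine (integrable_fun_norm_addHaar μ
      (f := fun y : ℝ => y ^ j * Real.exp (-y ^ 2))).2 ?_
    have h := integrableOn_rpow_mul_exp_neg_mul_sq (b := 1) one_pos
      (s := ((Module.finrank ℝ E - 1 + j : ℕ) : ℝ))
      (by have : (0 : ℝ) ≤ ((Module.finrank ℝ E - 1 + j : ℕ) : ℝ) := Nat.cast_nonneg _
          linarith)
    refine h.congr_fun (fun y _ => ?_) measurableSet_Ioi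
    simp only [Real.rpow_natCast, smul_eq_mul, pow_add]
    ring_nf
  refine (((hpow 0).add (hpow k)).const_mul (2 ^ (k - 1))).mono'
    (by fun_prop) (Filter.Eventually.of_forall fun v => ?_)
  have h := add_pow_le (zero_le_one' ℝ) (norm_nonneg v) k
  rw [Real.norm_of_nonneg (by positivity)]
  calc (1 + ‖v‖) ^ k * Real.exp (-‖v‖ ^ 2)
      ≤ (2 ^ (k - 1) * (1 ^ k + ‖v‖ ^ k)) * Real.exp (-‖v‖ ^ 2) := by gcongr
    _ = _ := by simp; ring

/-- The normalization constant of `gaussianProb`. -/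
def gaussianMass : ℝ := ∫ v, Real.exp (-‖v‖ ^ 2) ∂μ

theorem integrable_exp_neg_norm_sq : Integrable (fun v : E => Real.exp (-‖v‖ ^ 2)) μ := by
  simpa using integrable_one_add_norm_pow_mul_exp μ 0

theorem gaussianMass_pos : 0 < gaussianMass μ :=
  integral_exp_pos (integrable_exp_neg_norm_sq μ)

/-- The probability measure with density proportional to `exp (-‖v‖²)`. -/
def gaussianProb : Measure E :=
  μ.withDensity fun v => ENNReal.ofReal ((gaussianMass μ)⁻¹ * Real.exp (-‖v‖ ^ 2))

theorem integral_gaussianProb {F : Type*} [NormedAddCommGroup F] [NormedSpace ℝ F] (f : E → F) :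
    ∫ v, f v ∂(gaussianProb μ) =
      (gaussianMass μ)⁻¹ • ∫ v, Real.exp (-‖v‖ ^ 2) • f v ∂μ := by
  have h0 := (gaussianMass_pos μ).le
  rw [gaussianProb, integral_withDensity_eq_integral_toReal_smul (by fun_prop) (by simp),
    ← integral_smul]
  refine integral_congr_ae (.of_forall fun v => ?_)
  simp only
  rw [ENNReal.toReal_ofReal (by positivity), mul_smul]

theorem integrable_gaussianProb_iff {F : Type*} [NormedAddCommGroup F] [NormedSpace ℝ F]
    {f : E → F} :
    Integrable f (gaussianProb μ) ↔ Integrable (fun v => Real.exp (-‖v‖ ^ 2) • f v) μ := by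
  have h0 := gaussianMass_pos μ
  rw [gaussianProb, integrable_withDensity_iff_integrable_smul' (by fun_prop) (by simp),
    ← integrable_smul_iff (inv_ne_zero h0.ne') fun v => Real.exp (-‖v‖ ^ 2) • f v]
  refine integrable_congr (.of_forall fun v => ?_)
  simp only [Pi.smul_apply]
  rw [ENNReal.toReal_ofReal (by positivity), mul_smul]

instance : IsProbabilityMeasure (gaussianProb μ) := by
  have h0 := gaussianMass_pos μ
  refine ⟨?_⟩
  rw [gaussianProb, withDensity_apply _ MeasurableSet.univ, Measure.restrict_univ,
    ← ofReal_integral_eq_lintegral_ofReal ((integrable_exp_neg_norm_sq μ).const_mul _)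
      (.of_forall fun v => by positivity), integral_const_mul, ← gaussianMass,
    inv_mul_cancel₀ h0.ne', ENNReal.ofReal_one]

theorem integrable_gaussianProb_of_bound {F : Type*} [NormedAddCommGroup F] [NormedSpace ℝ F]
    {f : E → F} (hf : AEStronglyMeasurable f μ) {C : ℝ} {k : ℕ}
    (hC : ∀ v, ‖f v‖ ≤ C * (1 + ‖v‖) ^ k) : Integrable f (gaussianProb μ) := by
  rw [integrable_gaussianProb_iff]
  refine ((integrable_one_add_norm_pow_mul_exp μ k).const_mul C).mono'
    ((by fun_prop : Continuous fun v : E => Real.exp (-‖v‖ ^ 2)).aestronglyMeasurable.smul hf)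
    (.of_forall fun v => ?_)
  rw [norm_smul, Real.norm_of_nonneg (Real.exp_pos _).le]
  nlinarith [mul_le_mul_of_nonneg_right (hC v) (Real.exp_pos (-‖v‖ ^ 2)).le]

theorem integral_eq_sphere_mul_radial (f : Metric.sphere (0 : E) 1 → ℝ) (g : ℝ → ℝ) (F : E → ℝ)
    (hF : ∀ (θ : Metric.sphere (0 : E) 1) (r : ℝ), 0 < r → F (r • (θ : E)) = f θ * g r) :
    ∫ v, F v ∂μ = (∫ θ, f θ ∂μ.toSphere) *
      ∫ r : Set.Ioi (0 : ℝ), g r ∂(Measure.volumeIoiPow (Module.finrank ℝ E - 1)) := by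
  rw [← integral_prod_mul]
  calc ∫ v, F v ∂μ = ∫ x : ({(0)}ᶜ : Set E), F x.1 ∂(μ.comap (↑)) := by
        rw [integral_subtype_comap (measurableSet_singleton _).compl fun x => F x,
          restrict_compl_singleton]
    _ = ∫ x : ({(0)}ᶜ : Set E), f (homeomorphUnitSphereProd E x).1 *
          g (homeomorphUnitSphereProd E x).2 ∂(μ.comap (↑)) := by
        refine integral_congr_ae (.of_forall fun x => ?_)
        have h := hF (homeomorphUnitSphereProd E x).1 (homeomorphUnitSphereProd E x).2
          (homeomorphUnitSphereProd E x).2.2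
        simp only at h ⊢
        rw [← h]
        congr 1
        simp [smul_smul, mul_inv_cancel₀ (norm_ne_zero_iff.2 (show (x : E) ≠ 0 from x.2))]
    _ = _ := (μ.measurePreserving_homeomorphUnitSphereProd).integral_comp
          (Homeomorph.measurableEmbedding _) (fun p : Metric.sphere (0 : E) 1 × Set.Ioi (0 : ℝ) =>
            f p.1 * g p.2)

/-- Averages over the unit sphere are Gaussian averages of `2`-homogeneous extensions. -/
theorem integral_gaussianProb_homogeneous (f : Metric.sphere (0 : E) 1 → ℝ) (F : E → ℝ)
    (hF : ∀ (θ : Metric.sphere (0 : E) 1) (r : ℝ), 0 < r → F (r • (θ : E)) = r ^ 2 * f θ) :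
    ∫ v, F v ∂(gaussianProb μ) =
      (∫ θ, f θ ∂((μ.toSphere Set.univ)⁻¹ • μ.toSphere)) * ∫ v, ‖v‖ ^ 2 ∂(gaussianProb μ) := by
  have hnorm : ∀ (θ : Metric.sphere (0 : E) 1) (r : ℝ), 0 < r → ‖r • (θ : E)‖ = r := by
    intro θ r hr
    rw [norm_smul, norm_eq_of_mem_sphere, mul_one, Real.norm_of_nonneg hr.le]
  have hs : μ.toSphere.real Set.univ ≠ 0 := by
    rw [Measure.real, ne_eq, ENNReal.toReal_eq_zero_iff, not_or]
    exact ⟨Measure.measure_univ_ne_zero.2 μ.toSphere_ne_zero, measure_ne_top _ _⟩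
  rw [integral_gaussianProb, integral_gaussianProb,
    integral_eq_sphere_mul_radial μ f (fun r => Real.exp (-r ^ 2) * r ^ 2)
      (fun v => Real.exp (-‖v‖ ^ 2) • F v)
      (fun θ r hr => by simp only [hnorm θ r hr, hF θ r hr, smul_eq_mul]; ring),
    integral_eq_sphere_mul_radial μ (fun _ => 1) (fun r => Real.exp (-r ^ 2) * r ^ 2)
      (fun v => Real.exp (-‖v‖ ^ 2) • ‖v‖ ^ 2)
      (fun θ r hr => by simp only [hnorm θ r hr, smul_eq_mul]; ring),
    integral_smul_measure, integral_const, ENNReal.toReal_inv, ← Measure.real]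
  simp only [smul_eq_mul, mul_one]
  field_simp

end GaussianProb

section PolynomialGrowth

variable {E : Type*} [NormedAddCommGroup E]

/-- Continuous functions of at most polynomial growth. -/
def PolyGrowth (f : E → ℂ) : Prop :=
  Continuous f ∧ ∃ (C : ℝ) (k : ℕ), ∀ v, ‖f v‖ ≤ C * (1 + ‖v‖) ^ k

namespace PolyGrowth

theorem of_bounded {f : E → ℂ} (hf : Continuous f) (C : ℝ) (hC : ∀ v, ‖f v‖ ≤ C) :
    PolyGrowth f :=
  ⟨hf, C, 0, fun v => by simpa using hC v⟩

theorem const (c : ℂ) : PolyGrowth (fun _ : E => c) :=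
  of_bounded continuous_const ‖c‖ fun _ => le_rfl

theorem add {f g : E → ℂ} (hf : PolyGrowth f) (hg : PolyGrowth g) :
    PolyGrowth (fun v => f v + g v) := by
  obtain ⟨hfc, C, k, hf⟩ := hf
  obtain ⟨hgc, D, l, hg⟩ := hg
  refine ⟨hfc.add hgc, |C| + |D|, k + l, fun v => (norm_add_le _ _).trans ?_⟩
  have h1 : (1 : ℝ) ≤ 1 + ‖v‖ := by linarith [norm_nonneg v]
  have hk : (1 + ‖v‖) ^ k ≤ (1 + ‖v‖) ^ (k + l) := pow_le_pow_right₀ h1 (by omega)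
  have hl : (1 + ‖v‖) ^ l ≤ (1 + ‖v‖) ^ (k + l) := pow_le_pow_right₀ h1 (by omega)
  calc ‖f v‖ + ‖g v‖ ≤ |C| * (1 + ‖v‖) ^ k + |D| * (1 + ‖v‖) ^ l := by
        refine add_le_add ((hf v).trans ?_) ((hg v).trans ?_) <;> gcongr <;> exact le_abs_self _
    _ ≤ |C| * (1 + ‖v‖) ^ (k + l) + |D| * (1 + ‖v‖) ^ (k + l) := by gcongr
    _ = _ := by ring

theorem mul {f g : E → ℂ} (hf : PolyGrowth f) (hg : PolyGrowth g) :
    PolyGrowth (fun v => f v * g v) := by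
  obtain ⟨hfc, C, k, hf⟩ := hf
  obtain ⟨hgc, D, l, hg⟩ := hg
  refine ⟨hfc.mul hgc, C * D, k + l, fun v => ?_⟩
  rw [norm_mul]
  calc ‖f v‖ * ‖g v‖ ≤ (C * (1 + ‖v‖) ^ k) * (D * (1 + ‖v‖) ^ l) :=
        mul_le_mul (hf v) (hg v) (norm_nonneg _) ((norm_nonneg _).trans (hf v))
    _ = _ := by ring

theorem neg {f : E → ℂ} (hf : PolyGrowth f) : PolyGrowth (fun v => -f v) := by
  simpa using (const (-1)).mul hf

theorem sum {ι : Type*} (s : Finset ι) {f : ι → E → ℂ} (hf : ∀ i ∈ s, PolyGrowth (f i)) :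
    PolyGrowth (fun v => ∑ i ∈ s, f i v) := by
  classical
  induction s using Finset.induction_on with
  | empty => simpa using const (E := E) 0
  | insert i s hi ih =>
    simp only [Finset.sum_insert hi]
    exact (hf i (by simp)).add (ih fun j hj => hf j (by simp [hj]))

theorem conj {f : E → ℂ} (hf : PolyGrowth f) : PolyGrowth (fun v => starRingEnd ℂ (f v)) := by
  obtain ⟨hfc, C, k, hf⟩ := hf
  exact ⟨Complex.continuous_conj.comp hfc, C, k, fun v => by simpa using hf v⟩

theorem matrix_mul {l m n : Type*} [Fintype m] {M : E → Matrix l m ℂ} {N : E → Matrix m n ℂ}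
    (hM : ∀ i j, PolyGrowth fun v => M v i j) (hN : ∀ i j, PolyGrowth fun v => N v i j) (i : l)
    (j : n) : PolyGrowth fun v => (M v * N v) i j := by
  simp only [Matrix.mul_apply]
  exact sum _ fun k _ => (hM i k).mul (hN k j)

theorem trace {m : Type*} [Fintype m] {M : E → Matrix m m ℂ}
    (hM : ∀ i j, PolyGrowth fun v => M v i j) : PolyGrowth fun v => (M v).trace := by
  simp only [Matrix.trace, Matrix.diag_apply]
  exact sum _ fun k _ => hM k k

theorem integrable [NormedSpace ℝ E] [FiniteDimensional ℝ E] [MeasurableSpace E] [BorelSpace E]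
    [Nontrivial E] {μ : Measure E} [μ.IsAddHaarMeasure] {f : E → ℂ} (hf : PolyGrowth f) :
    Integrable f (gaussianProb μ) := by
  obtain ⟨hfc, C, k, hf⟩ := hf
  exact integrable_gaussianProb_of_bound μ hfc.aestronglyMeasurable hf

end PolyGrowth

end PolynomialGrowth

section Wirtinger

theorem polyGrowth_coord {ι : Type*} [Fintype ι] (a : ι) :
    PolyGrowth fun v : EuclideanSpace ℂ ι => v a := by
  refine ⟨by fun_prop, 1, 1, fun v => ?_⟩
  have := PiLp.norm_apply_le v a
  linarith

variable {ι : Type*} [DecidableEq ι]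

/-- `F` has Wirtinger derivatives `D` (holomorphic) and `D'` (antiholomorphic) at `v` with respect
to the coordinate `a`. -/
def HasWirtingerAt (F : EuclideanSpace ℂ ι → ℂ) (D D' : ℂ) (v : EuclideanSpace ℂ ι) (a : ι) :
    Prop :=
  ∀ c : ℂ, HasLineDerivAt ℝ F (c * D + starRingEnd ℂ c * D') v (EuclideanSpace.single a c)

namespace HasWirtingerAt

variable {F G : EuclideanSpace ℂ ι → ℂ} {D D' K K' : ℂ} {v : EuclideanSpace ℂ ι} {a : ι}

theorem const (z : ℂ) : HasWirtingerAt (fun _ => z) 0 0 v a := fun c => by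
  simpa [HasLineDerivAt] using hasDerivAt_const (0 : ℝ) z

theorem mul (hF : HasWirtingerAt F D D' v a) (hG : HasWirtingerAt G K K' v a) :
    HasWirtingerAt (fun v => F v * G v) (D * G v + F v * K) (D' * G v + F v * K') v a := fun c =>
  (HasDerivAt.mul (hF c) (hG c)).congr_deriv (by simp; ring)

theorem sum {κ : Type*} (s : Finset κ) {F : κ → EuclideanSpace ℂ ι → ℂ} {D D' : κ → ℂ}
    (hF : ∀ i ∈ s, HasWirtingerAt (F i) (D i) (D' i) v a) :
    HasWirtingerAt (fun v => ∑ i ∈ s, F i v) (∑ i ∈ s, D i) (∑ i ∈ s, D' i) v a := fun c =>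
  (HasDerivAt.fun_sum fun i hi => hF i hi c).congr_deriv (by
    simp [Finset.mul_sum, Finset.sum_add_distrib])

theorem coord (b : ι) : HasWirtingerAt (fun v => v b) (if b = a then 1 else 0) 0 v a := fun c => by
  have h : HasDerivAt (fun s : ℝ => v b + (s : ℂ) * (if b = a then c else 0))
      (1 * (if b = a then c else 0)) 0 :=
    ((Complex.ofRealCLM.hasDerivAt (x := (0 : ℝ))).mul_const _).const_add _
  refine (h.congr_deriv (by simp)).congr_of_eventuallyEq (.of_forall fun s => ?_)
  simp

theorem conj (hF : HasWirtingerAt F D D' v a) :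
    HasWirtingerAt (fun v => starRingEnd ℂ (F v)) (starRingEnd ℂ D') (starRingEnd ℂ D) v a :=
  fun c => (HasDerivAt.star (hF c)).congr_deriv (by simp; ring)

theorem matrix_mul {l m n : Type*} [Fintype m] {M : EuclideanSpace ℂ ι → Matrix l m ℂ}
    {N : EuclideanSpace ℂ ι → Matrix m n ℂ} {D D' : Matrix l m ℂ} {K K' : Matrix m n ℂ}
    (hM : ∀ i j, HasWirtingerAt (fun v => M v i j) (D i j) (D' i j) v a)
    (hN : ∀ i j, HasWirtingerAt (fun v => N v i j) (K i j) (K' i j) v a) (i : l) (j : n) :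
    HasWirtingerAt (fun v => (M v * N v) i j) ((D * N v + M v * K) i j)
      ((D' * N v + M v * K') i j) v a := by
  simp only [Matrix.mul_apply, Matrix.add_apply, ← Finset.sum_add_distrib]
  exact sum _ fun k _ => (hM i k).mul (hN k j)

theorem trace {m : Type*} [Fintype m] {M : EuclideanSpace ℂ ι → Matrix m m ℂ} {D D' : Matrix m m ℂ}
    (hM : ∀ i j, HasWirtingerAt (fun v => M v i j) (D i j) (D' i j) v a) :
    HasWirtingerAt (fun v => (M v).trace) D.trace D'.trace v a := by
  simp only [Matrix.trace, Matrix.diag_apply]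
  exact sum _ fun k _ => hM k k

end HasWirtingerAt

variable [Fintype ι]

theorem norm_add_smul_single_sq (v : EuclideanSpace ℂ ι) (a : ι) (c : ℂ) (s : ℝ) :
    ‖v + s • EuclideanSpace.single a c‖ ^ 2 =
      ‖v‖ ^ 2 + s * (2 * (starRingEnd ℂ (v a) * c).re) + s ^ 2 * ‖c‖ ^ 2 := by
  have h : s • EuclideanSpace.single a c = EuclideanSpace.single a ((s : ℂ) * c) := by
    ext b
    by_cases hb : b = a <;> simp [hb]
  rw [h, norm_add_sq (𝕜 := ℂ), EuclideanSpace.inner_single_right, PiLp.norm_single]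
  simp [mul_pow]
  ring

theorem hasLineDerivAt_exp_neg_norm_sq (v : EuclideanSpace ℂ ι) (a : ι) (c : ℂ) :
    HasLineDerivAt ℝ (fun v : EuclideanSpace ℂ ι => Real.exp (-‖v‖ ^ 2))
      (Real.exp (-‖v‖ ^ 2) * (-(2 * (starRingEnd ℂ (v a) * c).re))) v
      (EuclideanSpace.single a c) := by
  unfold HasLineDerivAt
  simp only [norm_add_smul_single_sq]
  have h : HasDerivAt (fun s : ℝ => -(‖v‖ ^ 2 + s * (2 * (starRingEnd ℂ (v a) * c).re) +
      s ^ 2 * ‖c‖ ^ 2)) (-(2 * (starRingEnd ℂ (v a) * c).re)) 0 := by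
    refine ((((hasDerivAt_id (0 : ℝ)).mul_const _).const_add _).add
      (((hasDerivAt_id (0 : ℝ)).pow 2).mul_const _)).neg.congr_deriv ?_
    simp
  simpa using h.exp

/-- Gaussian integration by parts. -/
theorem integral_conj_coord_mul [Nonempty ι]
    (μ : Measure (EuclideanSpace ℂ ι)) [μ.IsAddHaarMeasure]
    {F D D' : EuclideanSpace ℂ ι → ℂ} {a : ι} (hF : PolyGrowth F) (hD : PolyGrowth D)
    (hD' : PolyGrowth D') (h : ∀ v, HasWirtingerAt F (D v) (D' v) v a) :
    ∫ v, starRingEnd ℂ (v a) * F v ∂(gaussianProb μ) = ∫ v, D v ∂(gaussianProb μ) := by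
  have key : ∀ c : ℂ, ∫ v, (c * D v + starRingEnd ℂ c * D' v) ∂(gaussianProb μ) =
      ∫ v, ((2 * (starRingEnd ℂ (v a) * c).re : ℝ) : ℂ) * F v ∂(gaussianProb μ) := by
    intro c
    have hK : PolyGrowth fun v => c * D v + starRingEnd ℂ c * D' v :=
      ((PolyGrowth.const c).mul hD).add ((PolyGrowth.const _).mul hD')
    have hL : PolyGrowth fun v : EuclideanSpace ℂ ι =>
        ((2 * (starRingEnd ℂ (v a) * c).re : ℝ) : ℂ) * F v := by
      refine PolyGrowth.mul ?_ hF
      have h1 := (polyGrowth_coord a).conj.mul (PolyGrowth.const c)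
      simpa only [Complex.add_conj] using h1.add h1.conj
    have := integral_bilinear_hasLineDerivAt_right_eq_neg_left_of_integrable
      (μ := μ) (B := ContinuousLinearMap.lsmul ℝ ℝ) (v := EuclideanSpace.single a c)
      (f := fun v => Real.exp (-‖v‖ ^ 2)) (g := F)
      (f' := fun v => Real.exp (-‖v‖ ^ 2) * (-(2 * (starRingEnd ℂ (v a) * c).re)))
      (g' := fun v => c * D v + starRingEnd ℂ c * D' v)
      ?_ ?_ ?_ (fun v _ => hasLineDerivAt_exp_neg_norm_sq v a c) (fun v _ => h v c)
    · rw [integral_gaussianProb, integral_gaussianProb]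
      simp only [ContinuousLinearMap.lsmul_apply] at this
      rw [this, ← integral_neg]
      congr 1
      refine integral_congr_ae (.of_forall fun v => ?_)
      simp only [Complex.real_smul]
      push_cast
      ring
    · have := ((integrable_gaussianProb_iff μ).1 hL.integrable).neg
      refine this.congr (.of_forall fun v => ?_)
      simp only [Pi.neg_apply, ContinuousLinearMap.lsmul_apply, Complex.real_smul]
      push_cast
      ring
    · exact (integrable_gaussianProb_iff μ).1 hK.integrable
    · exact (integrable_gaussianProb_iff μ).1 hF.integrable
  have h1 := key 1
  have h2 := key Complex.I
  have hP : Integrable (fun v => starRingEnd ℂ (v a) * F v) (gaussianProb μ) :=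
    ((polyGrowth_coord a).conj.mul hF).integrable
  have hQ : Integrable (fun v => v a * F v) (gaussianProb μ) :=
    ((polyGrowth_coord a).mul hF).integrable
  have e1 : ∀ v : EuclideanSpace ℂ ι, ((2 * (starRingEnd ℂ (v a) * 1).re : ℝ) : ℂ) * F v =
      starRingEnd ℂ (v a) * F v + v a * F v := fun v => by
    rw [← Complex.add_conj]
    simp
    ring
  have e2 : ∀ v : EuclideanSpace ℂ ι,
      ((2 * (starRingEnd ℂ (v a) * Complex.I).re : ℝ) : ℂ) * F v =
      Complex.I * (starRingEnd ℂ (v a) * F v) + -Complex.I * (v a * F v) := fun v => by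
    rw [← Complex.add_conj]
    simp
    ring
  simp only [e1, e2, Complex.conj_I, map_one] at h1 h2
  rw [integral_add (hD.integrable.const_mul _) (hD'.integrable.const_mul _),
    integral_add hP hQ] at h1
  rw [integral_add (hD.integrable.const_mul _) (hD'.integrable.const_mul _),
    integral_add (hP.const_mul _) (hQ.const_mul _)] at h2
  simp only [integral_const_mul] at h1 h2
  have h3 := mul_left_cancel₀ Complex.I_ne_zero
    (show Complex.I * (∫ v, D v ∂(gaussianProb μ) - ∫ v, D' v ∂(gaussianProb μ)) =
      Complex.I * (∫ v, starRingEnd ℂ (v a) * F v ∂(gaussianProb μ) -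
        ∫ v, v a * F v ∂(gaussianProb μ)) by linear_combination h2)
  linear_combination -(1 / 2) * h1 - (1 / 2) * h3

end Wirtinger

section MatrixInverse

open Topology

theorem tendsto_matrix_inv {ι X : Type*} [Fintype ι] [DecidableEq ι] {l : Filter X}
    {M : X → Matrix ι ι ℂ} {M₀ : Matrix ι ι ℂ} (hM : Tendsto M l (𝓝 M₀)) (hu : IsUnit M₀) :
    Tendsto (fun x => (M x)⁻¹) l (𝓝 M₀⁻¹) := by
  have hdet : M₀.det ≠ 0 := ((Matrix.isUnit_iff_isUnit_det _).1 hu).ne_zero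
  have h1 : Tendsto (fun x => (M x).det) l (𝓝 M₀.det) :=
    (continuous_id.matrix_det.tendsto M₀).comp hM
  have h2 : Tendsto (fun x => (M x).adjugate) l (𝓝 M₀.adjugate) :=
    (continuous_id.matrix_adjugate.tendsto M₀).comp hM
  simp only [Matrix.inv_def, Ring.inverse_eq_inv']
  exact (h1.inv₀ hdet).smul h2

theorem hasDerivAt_matrix_inv {ι : Type*} [Fintype ι] [DecidableEq ι]
    {M : ℝ → Matrix ι ι ℂ} {M' : Matrix ι ι ℂ} {x : ℝ}
    (hM : ∀ i j, HasDerivAt (fun s => M s i j) (M' i j) x) (hu : ∀ s, IsUnit (M s)) (i j : ι) :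
    HasDerivAt (fun s => (M s)⁻¹ i j) ((-((M x)⁻¹ * M' * (M x)⁻¹)) i j) x := by
  have hc : Tendsto M (𝓝[≠] x) (𝓝 (M x)) := by
    refine tendsto_pi_nhds.2 fun i => tendsto_pi_nhds.2 fun j => ?_
    exact (hM i j).continuousAt.tendsto.mono_left nhdsWithin_le_nhds
  have hs : Tendsto (fun s => (s - x)⁻¹ • (M s - M x)) (𝓝[≠] x) (𝓝 M') := by
    refine tendsto_pi_nhds.2 fun i => tendsto_pi_nhds.2 fun j => ?_
    exact hasDerivAt_iff_tendsto_slope.1 (hM i j)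
  have hm := (((tendsto_matrix_inv hc (hu x)).mul hs).mul_const (M x)⁻¹).neg
  have hm' := tendsto_pi_nhds.1 (tendsto_pi_nhds.1 hm i) j
  refine hasDerivAt_iff_tendsto_slope.2 (hm'.congr fun s => ?_)
  have key : (M s)⁻¹ * (M s - M x) * (M x)⁻¹ = (M x)⁻¹ - (M s)⁻¹ := by
    rw [mul_sub, Matrix.nonsing_inv_mul _ ((Matrix.isUnit_iff_isUnit_det _).1 (hu s)), sub_mul,
      one_mul, mul_assoc, Matrix.mul_nonsing_inv _ ((Matrix.isUnit_iff_isUnit_det _).1 (hu x)),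
      mul_one]
  rw [mul_smul_comm, smul_mul_assoc, key, ← smul_neg, neg_sub]
  rfl

end MatrixInverse

section Resolvent

open scoped ComplexOrder

variable {m n : ℕ}

theorem schmidtSq_nonneg (v : TensorSp m n) (j : Fin m) : 0 ≤ schmidtSq v j :=
  (Matrix.posSemidef_self_mul_conjTranspose (coeffMatrix v)).eigenvalues_nonneg j

/-- The function `f` applied to the reduced density matrix of `v`. -/
def redFun (v : TensorSp m n) (f : ℝ → ℝ) : Matrix (Fin m) (Fin m) ℂ :=
  ((redDensity_isHermitian v).eigenvectorUnitary : Matrix (Fin m) (Fin m) ℂ) *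
    diagonal (fun j => ((f (schmidtSq v j) : ℝ) : ℂ)) *
      star ((redDensity_isHermitian v).eigenvectorUnitary : Matrix (Fin m) (Fin m) ℂ)

theorem redFun_id (v : TensorSp m n) : redFun v id = redDensity v :=
  ((redDensity_isHermitian v).spectral_theorem).symm

theorem redFun_mul (v : TensorSp m n) (f g : ℝ → ℝ) :
    redFun v f * redFun v g = redFun v fun x => f x * g x := by
  have h : star ((redDensity_isHermitian v).eigenvectorUnitary : Matrix (Fin m) (Fin m) ℂ) *
      ((redDensity_isHermitian v).eigenvectorUnitary : Matrix (Fin m) (Fin m) ℂ) = 1 :=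
    Unitary.coe_star_mul_self _
  unfold redFun
  simp only [Complex.ofReal_mul, ← diagonal_mul_diagonal]
  simp only [mul_assoc]
  rw [← mul_assoc (star _) _ (_ * star _), h, one_mul]

theorem redFun_const (v : TensorSp m n) (t : ℝ) : redFun v (fun _ => t) = (t : ℂ) • 1 := by
  unfold redFun
  rw [← Matrix.smul_one_eq_diagonal, mul_smul_comm, smul_mul_assoc, mul_one]
  exact congrArg _ (Unitary.coe_mul_star_self (redDensity_isHermitian v).eigenvectorUnitary)

theorem redFun_add (v : TensorSp m n) (f g : ℝ → ℝ) :
    redFun v f + redFun v g = redFun v fun x => f x + g x := by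
  unfold redFun
  simp only [Complex.ofReal_add, ← diagonal_add, mul_add, add_mul]

theorem redFun_congr (v : TensorSp m n) {f g : ℝ → ℝ} (h : ∀ x, 0 ≤ x → f x = g x) :
    redFun v f = redFun v g := by
  unfold redFun
  simp only [h _ (schmidtSq_nonneg v _)]

theorem trace_redFun (v : TensorSp m n) (f : ℝ → ℝ) :
    (redFun v f).trace = ((∑ j, f (schmidtSq v j) : ℝ) : ℂ) := by
  unfold redFun
  rw [Matrix.trace_mul_comm, ← mul_assoc, Unitary.coe_star_mul_self, one_mul, trace_diagonal]
  simp

theorem norm_redFun_apply_le (v : TensorSp m n) (f : ℝ → ℝ) (i j : Fin m) :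
    ‖redFun v f i j‖ ≤ ∑ k, |f (schmidtSq v k)| := by
  have hU := fun i j => entry_norm_bound_of_unitary
    (redDensity_isHermitian v).eigenvectorUnitary.2 i j
  unfold redFun
  rw [Matrix.mul_apply]
  refine (norm_sum_le _ _).trans (Finset.sum_le_sum fun k _ => ?_)
  rw [Matrix.mul_diagonal, norm_mul, norm_mul, Complex.norm_real, Real.norm_eq_abs,
    Matrix.star_apply, norm_star]
  calc _ ≤ 1 * |f (schmidtSq v k)| * 1 := by
        gcongr
        exacts [hU i k, hU j k]
    _ = _ := by ring

/-- The resolvent of the reduced density matrix. -/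
def densityResolvent (t : ℝ) (v : TensorSp m n) : Matrix (Fin m) (Fin m) ℂ :=
  (redDensity v + (t : ℂ) • 1)⁻¹

theorem redDensity_add_smul_one (t : ℝ) (v : TensorSp m n) :
    redDensity v + (t : ℂ) • 1 = redFun v fun x => x + t := by
  rw [← redFun_id, ← redFun_const, redFun_add]
  rfl

theorem densityResolvent_eq {t : ℝ} (ht : 0 < t) (v : TensorSp m n) :
    densityResolvent t v = redFun v fun x => (x + t)⁻¹ := by
  unfold densityResolvent
  refine Matrix.inv_eq_right_inv ?_
  rw [redDensity_add_smul_one, redFun_mul, redFun_congr v (g := fun _ => 1), redFun_const]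
  · simp
  · intro x hx
    exact mul_inv_cancel₀ (by positivity)

theorem isUnit_redDensity_add {t : ℝ} (ht : 0 < t) (v : TensorSp m n) :
    IsUnit (redDensity v + (t : ℂ) • 1) := by
  refine IsUnit.of_mul_eq_one (redFun v fun x => (x + t)⁻¹) ?_
  rw [redDensity_add_smul_one, redFun_mul, redFun_congr v (g := fun _ => 1), redFun_const]
  · simp
  · intro x hx
    exact mul_inv_cancel₀ (by positivity)

theorem continuous_coeffMatrix : Continuous (coeffMatrix (m := m) (n := n)) := by
  refine continuous_matrix fun i j => ?_
  simp only [coeffMatrix, Matrix.of_apply]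
  fun_prop

theorem continuous_redDensity : Continuous (redDensity (m := m) (n := n)) :=
  continuous_coeffMatrix.matrix_mul continuous_coeffMatrix.matrix_conjTranspose

theorem continuousAt_densityResolvent {p : TensorSp m n × ℝ} (hp : 0 < p.2) :
    ContinuousAt (fun p : TensorSp m n × ℝ => densityResolvent p.2 p.1) p := by
  refine tendsto_matrix_inv ?_ (isUnit_redDensity_add hp p.1)
  refine Continuous.tendsto ?_ p
  refine (continuous_redDensity.comp continuous_fst).add ?_
  exact (Complex.continuous_ofReal.comp continuous_snd).smul continuous_const

theorem continuous_densityResolvent {t : ℝ} (ht : 0 < t) :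
    Continuous (densityResolvent (m := m) (n := n) t) :=
  continuous_iff_continuousAt.2 fun v =>
    ContinuousAt.comp (f := fun v : TensorSp m n => (v, t)) (continuousAt_densityResolvent (p := (v, t)) ht)
      (by fun_prop)

theorem polyGrowth_densityResolvent {t : ℝ} (ht : 0 < t) (i j : Fin m) :
    PolyGrowth fun v : TensorSp m n => densityResolvent t v i j := by
  refine PolyGrowth.of_bounded ((continuous_densityResolvent ht).matrix_elem i j) (∑ _ : Fin m, t⁻¹)
    fun v => ?_
  rw [densityResolvent_eq ht]
  refine (norm_redFun_apply_le v _ i j).trans (Finset.sum_le_sum fun k _ => ?_)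
  have := schmidtSq_nonneg v k
  rw [abs_of_nonneg (by positivity)]
  gcongr
  linarith

theorem polyGrowth_coeffMatrix (i : Fin m) (j : Fin n) :
    PolyGrowth fun v : TensorSp m n => coeffMatrix v i j :=
  polyGrowth_coord (i, j)

theorem polyGrowth_conjTranspose_coeffMatrix (i : Fin n) (j : Fin m) :
    PolyGrowth fun v : TensorSp m n => (coeffMatrix v)ᴴ i j :=
  (polyGrowth_coord (j, i)).conj

theorem hasWirtingerAt_coeffMatrix (v : TensorSp m n) (p : Fin m) (q : Fin n) (i : Fin m)
    (j : Fin n) : HasWirtingerAt (fun v : TensorSp m n => coeffMatrix v i j)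
      (Matrix.single p q (1 : ℂ) i j) ((0 : Matrix (Fin m) (Fin n) ℂ) i j) v (p, q) := by
  have h : Matrix.single p q (1 : ℂ) i j = if (i, j) = (p, q) then 1 else 0 := by
    simp [Matrix.single_apply, eq_comm]
  rw [h]
  exact HasWirtingerAt.coord (i, j)

theorem hasWirtingerAt_conjTranspose_coeffMatrix (v : TensorSp m n) (p : Fin m) (q : Fin n)
    (i : Fin n) (j : Fin m) : HasWirtingerAt (fun v : TensorSp m n => (coeffMatrix v)ᴴ i j)
      ((0 : Matrix (Fin n) (Fin m) ℂ) i j) (Matrix.single q p (1 : ℂ) i j) v (p, q) := by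
  have h : Matrix.single q p (1 : ℂ) i j =
      starRingEnd ℂ (if (j, i) = (p, q) then 1 else 0) := by
    simp [Matrix.single_apply, eq_comm, and_comm, apply_ite]
  have h0 : (0 : Matrix (Fin n) (Fin m) ℂ) i j = starRingEnd ℂ 0 := by simp
  rw [h, h0]
  exact (HasWirtingerAt.coord (j, i)).conj

theorem hasWirtingerAt_redDensity (v : TensorSp m n) (p : Fin m) (q : Fin n) (i j : Fin m) :
    HasWirtingerAt (fun v : TensorSp m n => redDensity v i j)
      ((Matrix.single p q (1 : ℂ) * (coeffMatrix v)ᴴ) i j)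
      ((coeffMatrix v * Matrix.single q p (1 : ℂ)) i j) v (p, q) := by
  have := HasWirtingerAt.matrix_mul (hasWirtingerAt_coeffMatrix v p q)
    (hasWirtingerAt_conjTranspose_coeffMatrix v p q) i j
  simp only [Matrix.mul_zero, Matrix.zero_mul, add_zero, zero_add] at this
  exact this

theorem hasWirtingerAt_densityResolvent {t : ℝ} (ht : 0 < t) (v : TensorSp m n) (p : Fin m) (q : Fin n)
    (i j : Fin m) : HasWirtingerAt (fun v : TensorSp m n => densityResolvent t v i j)
      ((-(densityResolvent t v * (Matrix.single p q (1 : ℂ) * (coeffMatrix v)ᴴ) * densityResolvent t v)) i j)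
      ((-(densityResolvent t v * (coeffMatrix v * Matrix.single q p (1 : ℂ)) * densityResolvent t v)) i j)
      v (p, q) := by
  intro c
  have hW : ∀ i j, HasDerivAt (fun s : ℝ => (redDensity (v + s • EuclideanSpace.single (p, q) c) +
      (t : ℂ) • (1 : Matrix (Fin m) (Fin m) ℂ)) i j)
      ((c • (Matrix.single p q (1 : ℂ) * (coeffMatrix v)ᴴ) +
        starRingEnd ℂ c • (coeffMatrix v * Matrix.single q p (1 : ℂ))) i j) 0 := fun i j => by
    simpa using HasDerivAt.add_const (((t : ℂ) • (1 : Matrix (Fin m) (Fin m) ℂ)) i j)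
      (hasWirtingerAt_redDensity v p q i j c)
  have h := hasDerivAt_matrix_inv hW (fun s => isUnit_redDensity_add ht _) i j
  refine h.congr_deriv ?_
  simp only [zero_smul, add_zero, mul_add, add_mul, mul_smul_comm, smul_mul_assoc,
    Matrix.neg_apply, Matrix.add_apply, Matrix.smul_apply, smul_eq_mul, densityResolvent]
  ring

end Resolvent

section LoopEquations

variable {m n : ℕ}

theorem mul_single_mul_apply {a b c d : Type*} [Fintype b] [Fintype c] [DecidableEq b]
    [DecidableEq c] (X : Matrix a b ℂ) (Y : Matrix c d ℂ) (p : b) (q : c) (i : a) (j : d) :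
    (X * Matrix.single p q (1 : ℂ) * Y) i j = X i p * Y q j := by
  rw [Matrix.mul_apply, Finset.sum_eq_single q]
  · rw [Matrix.mul_single_apply_same, mul_one]
  · intro k _ hk
    rw [Matrix.mul_single_apply_of_ne _ _ _ _ _ hk, zero_mul]
  · simp

theorem integral_mul_trace_resolvent [NeZero m] [NeZero n] {t : ℝ} (ht : 0 < t)
    {φ : TensorSp m n → ℂ} {D D' : Fin m → Fin n → TensorSp m n → ℂ} (hφ : PolyGrowth φ)
    (hD : ∀ p q, PolyGrowth (D p q)) (hD' : ∀ p q, PolyGrowth (D' p q))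
    (h : ∀ p q v, HasWirtingerAt φ (D p q v) (D' p q v) v (p, q)) :
    ∫ v, φ v * ((coeffMatrix v)ᴴ * densityResolvent t v * coeffMatrix v).trace
        ∂(gaussianProb (volume : Measure (TensorSp m n))) =
      ∫ v, ((∑ p, ∑ q, D p q v * (densityResolvent t v * coeffMatrix v) p q) +
        φ v * (n * (densityResolvent t v).trace - (densityResolvent t v).trace *
          ((coeffMatrix v)ᴴ * densityResolvent t v * coeffMatrix v).trace))
        ∂(gaussianProb (volume : Measure (TensorSp m n))) := by
  have hR := polyGrowth_densityResolvent (m := m) (n := n) ht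
  have hA := polyGrowth_coeffMatrix (m := m) (n := n)
  have hAs := polyGrowth_conjTranspose_coeffMatrix (m := m) (n := n)
  have hRA := PolyGrowth.matrix_mul hR hA
  have hARA := PolyGrowth.matrix_mul (PolyGrowth.matrix_mul hAs hR) hA
  have hdiag : ∀ (p : Fin m) (q : Fin n), PolyGrowth fun v : TensorSp m n =>
      -(densityResolvent t v p p * ((coeffMatrix v)ᴴ * densityResolvent t v * coeffMatrix v) q q) +
        densityResolvent t v p p := fun p q => ((hR p p).mul (hARA q q)).neg.add (hR p p)
  have hdiag' : ∀ (p : Fin m) (q : Fin n), PolyGrowth fun v : TensorSp m n =>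
      (-(densityResolvent t v * (coeffMatrix v * Matrix.single q p (1 : ℂ)) *
        densityResolvent t v) * coeffMatrix v + densityResolvent t v *
          (0 : Matrix (Fin m) (Fin n) ℂ)) p q := by
    intro p q
    have hS : ∀ i j, PolyGrowth fun _ : TensorSp m n => Matrix.single q p (1 : ℂ) i j :=
      fun i j => PolyGrowth.const _
    have := PolyGrowth.matrix_mul (PolyGrowth.matrix_mul (PolyGrowth.matrix_mul hR
      (PolyGrowth.matrix_mul hA hS)) hR) hA p q
    simpa only [Matrix.neg_mul, Matrix.mul_zero, add_zero, Matrix.neg_apply] using this.neg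
  have stein : ∀ p q, ∫ v, starRingEnd ℂ (v (p, q)) *
        (φ v * (densityResolvent t v * coeffMatrix v) p q)
        ∂(gaussianProb (volume : Measure (TensorSp m n))) =
      ∫ v, (D p q v * (densityResolvent t v * coeffMatrix v) p q + φ v *
        (-(densityResolvent t v p p *
          ((coeffMatrix v)ᴴ * densityResolvent t v * coeffMatrix v) q q) +
          densityResolvent t v p p)) ∂(gaussianProb (volume : Measure (TensorSp m n))) := by
    intro p q
    have hF := hφ.mul (hRA p q)
    have hG := ((hD p q).mul (hRA p q)).add (hφ.mul (hdiag p q))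
    have hG' := ((hD' p q).mul (hRA p q)).add (hφ.mul (hdiag' p q))
    refine integral_conj_coord_mul (a := (p, q)) (volume : Measure (TensorSp m n)) hF hG hG' fun v => ?_
    have hm := HasWirtingerAt.matrix_mul (M := densityResolvent t) (N := coeffMatrix)
      (D := -(densityResolvent t v * (Matrix.single p q (1 : ℂ) * (coeffMatrix v)ᴴ) *
        densityResolvent t v))
      (D' := -(densityResolvent t v * (coeffMatrix v * Matrix.single q p (1 : ℂ)) *
        densityResolvent t v)) (K := Matrix.single p q (1 : ℂ)) (K' := 0) (v := v) (a := (p, q))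
      (hasWirtingerAt_densityResolvent ht v p q) (hasWirtingerAt_coeffMatrix v p q) p q
    have hw := (h p q v).mul hm
    have e : (-(densityResolvent t v * (Matrix.single p q (1 : ℂ) * (coeffMatrix v)ᴴ) *
        densityResolvent t v) * coeffMatrix v + densityResolvent t v *
          Matrix.single p q (1 : ℂ)) p q =
        -(densityResolvent t v p p *
          ((coeffMatrix v)ᴴ * densityResolvent t v * coeffMatrix v) q q) +
          densityResolvent t v p p := by
      rw [Matrix.add_apply, Matrix.mul_single_apply_same, mul_one, Matrix.neg_mul,
        Matrix.neg_apply, ← mul_single_mul_apply]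
      simp only [Matrix.mul_assoc]
    rw [e] at hw
    exact hw
  have hsum := Finset.sum_congr rfl fun p (_ : p ∈ Finset.univ) =>
    Finset.sum_congr rfl fun q (_ : q ∈ Finset.univ) => stein p q
  have hint1 : ∀ p q, Integrable (fun v : TensorSp m n => starRingEnd ℂ (v (p, q)) *
      (φ v * (densityResolvent t v * coeffMatrix v) p q)) (gaussianProb volume) := fun p q =>
    ((polyGrowth_coord (p, q)).conj.mul (hφ.mul (hRA p q))).integrable
  have hint2 : ∀ p q, Integrable (fun v : TensorSp m n =>
      D p q v * (densityResolvent t v * coeffMatrix v) p q + φ v *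
        (-(densityResolvent t v p p *
          ((coeffMatrix v)ᴴ * densityResolvent t v * coeffMatrix v) q q) +
          densityResolvent t v p p)) (gaussianProb volume) := fun p q =>
    (((hD p q).mul (hRA p q)).add (hφ.mul (hdiag p q))).integrable
  simp only [← integral_finsetSum _ fun q _ => hint1 _ q,
    ← integral_finsetSum _ fun q _ => hint2 _ q] at hsum
  rw [← integral_finsetSum _ fun p _ => integrable_finsetSum _ fun q _ => hint1 p q,
    ← integral_finsetSum _ fun p _ => integrable_finsetSum _ fun q _ => hint2 p q] at hsum
  refine Eq.trans (integral_congr_ae (.of_forall fun v => ?_)) (hsum.trans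
    (integral_congr_ae (.of_forall fun v => ?_)))
  · dsimp only
    rw [Matrix.mul_assoc, Matrix.trace, Finset.mul_sum, Finset.sum_comm]
    refine Finset.sum_congr rfl fun q _ => ?_
    rw [Matrix.diag_apply, Matrix.mul_apply, Finset.mul_sum]
    refine Finset.sum_congr rfl fun p _ => ?_
    simp only [Matrix.conjTranspose_apply, coeffMatrix, Matrix.of_apply, RCLike.star_def]
    ring
  · dsimp only
    simp only [Finset.sum_add_distrib, ← Finset.mul_sum]
    congr 2
    simp only [Matrix.trace, Matrix.diag_apply, Finset.sum_neg_distrib, ← Finset.mul_sum,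
      ← Finset.sum_mul, Finset.sum_const, Finset.card_univ, Fintype.card_fin, nsmul_eq_mul]
    ring

/-- The Stieltjes transform `∑ j, 1 / (λ_j + t)` of the spectrum of the reduced density matrix. -/
def stieltjes (t : ℝ) (v : TensorSp m n) : ℝ := ∑ j, (schmidtSq v j + t)⁻¹

theorem trace_densityResolvent {t : ℝ} (ht : 0 < t) (v : TensorSp m n) :
    (densityResolvent t v).trace = (stieltjes t v : ℂ) := by
  rw [densityResolvent_eq ht, trace_redFun, stieltjes]

theorem trace_conj_densityResolvent {t : ℝ} (ht : 0 < t) (v : TensorSp m n) :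
    ((coeffMatrix v)ᴴ * densityResolvent t v * coeffMatrix v).trace =
      ((m - t * stieltjes t v : ℝ) : ℂ) := by
  rw [Matrix.mul_assoc, Matrix.trace_mul_comm, Matrix.mul_assoc,
    show coeffMatrix v * (coeffMatrix v)ᴴ = redDensity v from rfl, densityResolvent_eq ht,
    ← redFun_id, redFun_mul, trace_redFun, stieltjes, Finset.mul_sum]
  congr 1
  rw [eq_sub_iff_add_eq, ← Finset.sum_add_distrib]
  have : ∀ j ∈ Finset.univ, (schmidtSq v j + t)⁻¹ * id (schmidtSq v j) +
      t * (schmidtSq v j + t)⁻¹ = 1 := fun j _ => by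
    have := schmidtSq_nonneg v j
    have h : schmidtSq v j + t ≠ 0 := by positivity
    simp only [id]
    field_simp
  rw [Finset.sum_congr rfl this]
  simp

theorem trace_conj_densityResolvent_cube {t : ℝ} (ht : 0 < t) (v : TensorSp m n) :
    ((coeffMatrix v)ᴴ * densityResolvent t v * densityResolvent t v *
      (densityResolvent t v * coeffMatrix v)).trace =
      ((∑ j, schmidtSq v j * (schmidtSq v j + t)⁻¹ ^ 3 : ℝ) : ℂ) := by
  rw [Matrix.mul_assoc, Matrix.mul_assoc, Matrix.trace_mul_comm]
  simp only [Matrix.mul_assoc]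
  rw [show coeffMatrix v * (coeffMatrix v)ᴴ = redDensity v from rfl, densityResolvent_eq ht,
    ← redFun_id, redFun_mul, redFun_mul, redFun_mul, trace_redFun]
  congr 1
  refine Finset.sum_congr rfl fun j _ => ?_
  simp only [id]
  ring

theorem continuous_stieltjes {t : ℝ} (ht : 0 < t) :
    Continuous (stieltjes (m := m) (n := n) t) := by
  have : stieltjes (m := m) (n := n) t = fun v => (densityResolvent t v).trace.re := by
    funext v
    simp [trace_densityResolvent ht]
  rw [this]
  exact Complex.continuous_re.comp (continuous_densityResolvent ht).matrix_trace

theorem integral_loop_one [NeZero m] [NeZero n] {t : ℝ} (ht : 0 < t) :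
    ∫ v, (m - t * stieltjes t v) ∂(gaussianProb (volume : Measure (TensorSp m n))) =
      ∫ v, (n * stieltjes t v - stieltjes t v * (m - t * stieltjes t v))
        ∂(gaussianProb (volume : Measure (TensorSp m n))) := by
  have h := integral_mul_trace_resolvent (m := m) (n := n) ht (PolyGrowth.const 1)
    (fun p q => PolyGrowth.const 0) (fun p q => PolyGrowth.const 0)
    fun p q v => HasWirtingerAt.const 1
  simp only [trace_densityResolvent ht, trace_conj_densityResolvent ht, one_mul, zero_mul,
    Finset.sum_const_zero, zero_add] at h
  norm_cast at h

theorem integral_loop_two [NeZero m] [NeZero n] {t : ℝ} (ht : 0 < t) :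
    ∫ v, stieltjes t v * (m - t * stieltjes t v)
        ∂(gaussianProb (volume : Measure (TensorSp m n))) =
      ∫ v, (-(∑ j, schmidtSq v j * (schmidtSq v j + t)⁻¹ ^ 3) +
        stieltjes t v * (n * stieltjes t v - stieltjes t v * (m - t * stieltjes t v)))
        ∂(gaussianProb (volume : Measure (TensorSp m n))) := by
  have hR := polyGrowth_densityResolvent (m := m) (n := n) ht
  have hA := polyGrowth_coeffMatrix (m := m) (n := n)
  have hAs := polyGrowth_conjTranspose_coeffMatrix (m := m) (n := n)
  have hS : ∀ (p : Fin m) (q : Fin n) i j,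
      PolyGrowth fun _ : TensorSp m n => Matrix.single p q (1 : ℂ) i j :=
    fun p q i j => PolyGrowth.const _
  have hS' : ∀ (p : Fin m) (q : Fin n) i j,
      PolyGrowth fun _ : TensorSp m n => Matrix.single q p (1 : ℂ) i j :=
    fun p q i j => PolyGrowth.const _
  have h := integral_mul_trace_resolvent (m := m) (n := n) ht (PolyGrowth.trace hR)
    (fun p q => PolyGrowth.trace fun i j => by
      simpa only [Matrix.neg_apply] using (PolyGrowth.matrix_mul (PolyGrowth.matrix_mul hR
        (PolyGrowth.matrix_mul (hS p q) hAs)) hR i j).neg)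
    (fun p q => PolyGrowth.trace fun i j => by
      simpa only [Matrix.neg_apply] using (PolyGrowth.matrix_mul (PolyGrowth.matrix_mul hR
        (PolyGrowth.matrix_mul hA (hS' p q))) hR i j).neg)
    fun p q v => HasWirtingerAt.trace (hasWirtingerAt_densityResolvent ht v p q)
  have key : ∀ v : TensorSp m n, (∑ p, ∑ q, (-(densityResolvent t v *
      (Matrix.single p q (1 : ℂ) * (coeffMatrix v)ᴴ) * densityResolvent t v)).trace *
      (densityResolvent t v * coeffMatrix v) p q) =
      -((∑ j, schmidtSq v j * (schmidtSq v j + t)⁻¹ ^ 3 : ℝ) : ℂ) := by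
    intro v
    rw [← trace_conj_densityResolvent_cube ht, Finset.sum_comm, Matrix.trace,
      ← Finset.sum_neg_distrib]
    refine Finset.sum_congr rfl fun q _ => ?_
    rw [Matrix.diag_apply, Matrix.mul_apply, ← Finset.sum_neg_distrib]
    refine Finset.sum_congr rfl fun p _ => ?_
    rw [Matrix.trace_neg, Matrix.mul_assoc, Matrix.trace_mul_comm, Matrix.mul_assoc,
      Matrix.mul_assoc, Matrix.trace_single_mul, one_smul, neg_mul, ← Matrix.mul_assoc]
  simp only [key] at h
  simp only [trace_densityResolvent ht, trace_conj_densityResolvent ht] at h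
  norm_cast at h

end LoopEquations

section Moments

variable {ι : Type*} [Fintype ι]

theorem ofReal_norm_sq_eq_sum (v : EuclideanSpace ℂ ι) :
    ((‖v‖ ^ 2 : ℝ) : ℂ) = ∑ b, starRingEnd ℂ (v b) * v b := by
  rw [EuclideanSpace.norm_sq_eq]
  push_cast
  simp only [Complex.conj_mul']

theorem polyGrowth_norm_sq : PolyGrowth fun v : EuclideanSpace ℂ ι => ((‖v‖ ^ 2 : ℝ) : ℂ) := by
  simp only [ofReal_norm_sq_eq_sum]
  exact PolyGrowth.sum _ fun b _ => (polyGrowth_coord b).conj.mul (polyGrowth_coord b)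

variable [DecidableEq ι]

theorem hasWirtingerAt_norm_sq (v : EuclideanSpace ℂ ι) (a : ι) :
    HasWirtingerAt (fun v : EuclideanSpace ℂ ι => ((‖v‖ ^ 2 : ℝ) : ℂ)) (starRingEnd ℂ (v a)) (v a)
      v a := by
  simp only [ofReal_norm_sq_eq_sum]
  have h := HasWirtingerAt.sum (v := v) (a := a) Finset.univ
    fun b _ => (HasWirtingerAt.coord (v := v) (a := a) b).conj.mul (HasWirtingerAt.coord b)
  simpa [apply_ite] using h

variable [Nonempty ι] (μ : Measure (EuclideanSpace ℂ ι)) [μ.IsAddHaarMeasure]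

theorem integral_norm_sq_mul {φ : EuclideanSpace ℂ ι → ℂ} {D D' : ι → EuclideanSpace ℂ ι → ℂ}
    (hφ : PolyGrowth φ) (hD : ∀ a, PolyGrowth (D a)) (hD' : ∀ a, PolyGrowth (D' a))
    (h : ∀ a v, HasWirtingerAt φ (D a v) (D' a v) v a) :
    ∫ v, ((‖v‖ ^ 2 : ℝ) : ℂ) * φ v ∂(gaussianProb μ) =
      ∫ v, (Fintype.card ι * φ v + ∑ a, v a * D a v) ∂(gaussianProb μ) := by
  have hc := polyGrowth_coord (ι := ι)
  have stein : ∀ a, ∫ v, starRingEnd ℂ (v a) * (v a * φ v) ∂(gaussianProb μ) =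
      ∫ v, (φ v + v a * D a v) ∂(gaussianProb μ) := by
    intro a
    have hF := (hc a).mul hφ
    have hG := hφ.add ((hc a).mul (hD a))
    have hG' := (hc a).mul (hD' a)
    refine integral_conj_coord_mul μ hF hG hG' fun v => ?_
    simpa using (HasWirtingerAt.coord (v := v) (a := a) a).mul (h a v)
  have hsum := Finset.sum_congr rfl fun a (_ : a ∈ Finset.univ) => stein a
  have h1 : ∀ a, Integrable (fun v => starRingEnd ℂ (v a) * (v a * φ v)) (gaussianProb μ) :=
    fun a => ((hc a).conj.mul ((hc a).mul hφ)).integrable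
  have h2 : ∀ a, Integrable (fun v => φ v + v a * D a v) (gaussianProb μ) :=
    fun a => (hφ.add ((hc a).mul (hD a))).integrable
  rw [← integral_finsetSum _ fun a _ => h1 a, ← integral_finsetSum _ fun a _ => h2 a] at hsum
  refine Eq.trans (integral_congr_ae (.of_forall fun v => ?_)) (hsum.trans
    (integral_congr_ae (.of_forall fun v => ?_)))
  · dsimp only
    rw [ofReal_norm_sq_eq_sum, Finset.sum_mul]
    simp only [mul_assoc]
  · simp [Finset.sum_add_distrib]

theorem integral_norm_sq : ∫ v, ‖v‖ ^ 2 ∂(gaussianProb μ) = Fintype.card ι := by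
  have h := integral_norm_sq_mul μ (PolyGrowth.const 1) (fun a => PolyGrowth.const 0)
    (fun a => PolyGrowth.const 0) fun a v => HasWirtingerAt.const 1
  simp only [mul_one, mul_zero, Finset.sum_const_zero, add_zero, integral_const, probReal_univ,
    one_smul] at h
  exact_mod_cast h

theorem integral_norm_pow_four :
    ∫ v, (‖v‖ ^ 2) ^ 2 ∂(gaussianProb μ) = Fintype.card ι * (Fintype.card ι + 1) := by
  have h := integral_norm_sq_mul μ polyGrowth_norm_sq (fun a => (polyGrowth_coord a).conj)
    (fun a => polyGrowth_coord a) fun a v => hasWirtingerAt_norm_sq v a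
  have e : ∀ v : EuclideanSpace ℂ ι, (Fintype.card ι * ((‖v‖ ^ 2 : ℝ) : ℂ) +
      ∑ a, v a * starRingEnd ℂ (v a)) = (((Fintype.card ι + 1) * ‖v‖ ^ 2 : ℝ) : ℂ) := fun v => by
    simp only [mul_comm (v _), ← ofReal_norm_sq_eq_sum]
    push_cast
    ring
  simp only [e, ← Complex.ofReal_mul, integral_complex_ofReal] at h
  rw [Complex.ofReal_inj, integral_const_mul, integral_norm_sq] at h
  simp only [sq (‖_‖ ^ 2), h]
  ring

end Moments

section Cubic

variable {X : Type*} [MeasurableSpace X] {P : Measure X} [IsProbabilityMeasure P] {f : X → ℝ}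

theorem integrable_cubic (i1 : Integrable f P) (i2 : Integrable (fun v => f v ^ 2) P)
    (i3 : Integrable (fun v => f v ^ 3) P) (a b c d : ℝ) :
    Integrable (fun v => a * f v ^ 3 + b * f v ^ 2 + c * f v + d) P :=
  (((i3.const_mul a).add (i2.const_mul b)).add (i1.const_mul c)).add (integrable_const d)

theorem integral_cubic (i1 : Integrable f P) (i2 : Integrable (fun v => f v ^ 2) P)
    (i3 : Integrable (fun v => f v ^ 3) P) (a b c d : ℝ) :
    ∫ v, (a * f v ^ 3 + b * f v ^ 2 + c * f v + d) ∂P =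
    a * ∫ v, f v ^ 3 ∂P + b * ∫ v, f v ^ 2 ∂P + c * ∫ v, f v ∂P + d := by
  have h2 : Integrable (fun v => a * f v ^ 3 + b * f v ^ 2) P :=
    (i3.const_mul a).add (i2.const_mul b)
  have h1 : Integrable (fun v => a * f v ^ 3 + b * f v ^ 2 + c * f v) P :=
    h2.add (i1.const_mul c)
  rw [integral_add h1 (integrable_const d), integral_add h2 (i1.const_mul c),
    integral_add (i3.const_mul a) (i2.const_mul b), integral_const_mul, integral_const_mul,
    integral_const_mul]
  simp

end Cubic

section StieltjesBound

variable {m n : ℕ}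

theorem stieltjes_nonneg {t : ℝ} (ht : 0 < t) (v : TensorSp m n) : 0 ≤ stieltjes t v :=
  Finset.sum_nonneg fun j _ => by
    have := schmidtSq_nonneg v j
    positivity

theorem mul_stieltjes_le {t : ℝ} (ht : 0 < t) (v : TensorSp m n) : t * stieltjes t v ≤ m := by
  rw [stieltjes, Finset.mul_sum]
  refine (Finset.sum_le_card_nsmul _ _ 1 fun j _ => ?_).trans (by simp)
  have := schmidtSq_nonneg v j
  rw [← div_eq_mul_inv, div_le_one (by positivity)]
  linarith

theorem stieltjes_le {t : ℝ} (ht : 0 < t) (v : TensorSp m n) : stieltjes t v ≤ m / t := by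
  rw [le_div_iff₀ ht, mul_comm]
  exact mul_stieltjes_le ht v

theorem sum_mul_inv_cube_nonneg {t : ℝ} (ht : 0 < t) (v : TensorSp m n) :
    0 ≤ ∑ j, schmidtSq v j * (schmidtSq v j + t)⁻¹ ^ 3 :=
  Finset.sum_nonneg fun j _ => by
    have := schmidtSq_nonneg v j
    positivity

theorem sum_mul_inv_cube_le {t : ℝ} (ht : 0 < t) (v : TensorSp m n) :
    ∑ j, schmidtSq v j * (schmidtSq v j + t)⁻¹ ^ 3 ≤ m / t ^ 2 := by
  refine (Finset.sum_le_card_nsmul _ _ (1 / t ^ 2) fun j _ => ?_).trans (by simp [div_eq_mul_inv])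
  have h := schmidtSq_nonneg v j
  rw [inv_pow, ← div_eq_mul_inv, div_le_div_iff₀ (by positivity) (by positivity)]
  have h1 : t ^ 2 ≤ (schmidtSq v j + t) ^ 2 := by gcongr; linarith
  calc schmidtSq v j * t ^ 2 ≤ (schmidtSq v j + t) * (schmidtSq v j + t) ^ 2 := by
        gcongr
        linarith
    _ = _ := by ring

theorem continuous_sum_mul_inv_cube {t : ℝ} (ht : 0 < t) :
    Continuous fun v : TensorSp m n => ∑ j, schmidtSq v j * (schmidtSq v j + t)⁻¹ ^ 3 := by
  have : (fun v : TensorSp m n => ∑ j, schmidtSq v j * (schmidtSq v j + t)⁻¹ ^ 3) =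
      fun v => ((coeffMatrix v)ᴴ * densityResolvent t v * densityResolvent t v *
        (densityResolvent t v * coeffMatrix v)).trace.re := by
    funext v
    rw [trace_conj_densityResolvent_cube ht, Complex.ofReal_re]
  rw [this]
  have hR := continuous_densityResolvent (m := m) (n := n) ht
  have hA := continuous_coeffMatrix (m := m) (n := n)
  exact Complex.continuous_re.comp (((hA.matrix_conjTranspose.matrix_mul hR).matrix_mul
    hR).matrix_mul (hR.matrix_mul hA)).matrix_trace

variable [NeZero m] [NeZero n]

theorem integrable_stieltjes_pow {t : ℝ} (ht : 0 < t) (k : ℕ) :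
    Integrable (fun v => stieltjes t v ^ k)
      (gaussianProb (volume : Measure (TensorSp m n))) := by
  refine integrable_gaussianProb_of_bound (C := (m / t) ^ k) (k := 0) volume
    ((continuous_stieltjes ht).pow k).aestronglyMeasurable fun v => ?_
  have h := stieltjes_nonneg ht v
  rw [Real.norm_of_nonneg (by positivity), pow_zero, mul_one]
  exact pow_le_pow_left₀ h (stieltjes_le ht v) k

theorem integrable_sum_mul_inv_cube {t : ℝ} (ht : 0 < t) :
    Integrable (fun v : TensorSp m n => ∑ j, schmidtSq v j * (schmidtSq v j + t)⁻¹ ^ 3)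
      (gaussianProb (volume : Measure (TensorSp m n))) := by
  refine integrable_gaussianProb_of_bound (C := m / t ^ 2) (k := 0) volume
    (continuous_sum_mul_inv_cube ht).aestronglyMeasurable fun v => ?_
  rw [Real.norm_of_nonneg (sum_mul_inv_cube_nonneg ht v), pow_zero, mul_one]
  exact sum_mul_inv_cube_le ht v

theorem abs_integral_stieltjes_sub_le {t g : ℝ} (ht : 0 < t) (hmn : m ≤ n) (hg : 0 ≤ g)
    (hgt : g ^ 2 + (t + n - m) * g = m * t) :
    |t * ∫ v, stieltjes t v ∂(gaussianProb (volume : Measure (TensorSp m n))) - g| ≤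
      2 * m / (1 + t ^ 2) := by
  have h1 := integral_loop_one (m := m) (n := n) ht
  have h2 := integral_loop_two (m := m) (n := n) ht
  set P := gaussianProb (volume : Measure (TensorSp m n))
  set T := ∫ v, stieltjes t v ∂P with hT
  have i1 : Integrable (fun v : TensorSp m n => stieltjes t v) P := by
    simpa using integrable_stieltjes_pow (m := m) (n := n) ht 1
  have i2 : Integrable (fun v : TensorSp m n => stieltjes t v ^ 2) P :=
    integrable_stieltjes_pow ht 2
  have i3 : Integrable (fun v : TensorSp m n => stieltjes t v ^ 3) P :=
    integrable_stieltjes_pow ht 3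
  have ik := integrable_sum_mul_inv_cube (m := m) (n := n) ht
  set κ := ∫ v : TensorSp m n, ∑ j, schmidtSq v j * (schmidtSq v j + t)⁻¹ ^ 3 ∂P with hκ
  have hnm : (m : ℝ) ≤ n := by exact_mod_cast hmn
  have hκm : κ ≤ m / t ^ 2 := by
    calc κ ≤ ∫ _ : TensorSp m n, (m / t ^ 2 : ℝ) ∂P :=
          integral_mono ik (integrable_const _) fun v => sum_mul_inv_cube_le ht v
      _ = _ := by simp
  have cubic := integral_cubic i1 i2 i3
  have e1 : t * ∫ v, stieltjes t v ^ 2 ∂P + (t + n - m) * T - m = 0 := by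
    have l := cubic 0 0 (-t) m
    have r := cubic 0 t (n - m) 0
    rw [← integral_congr_ae (f := fun v : TensorSp m n => m - t * stieltjes t v)
      (.of_forall fun v => by ring)] at l
    rw [← integral_congr_ae (f := fun v : TensorSp m n =>
      n * stieltjes t v - stieltjes t v * (m - t * stieltjes t v))
      (.of_forall fun v => by ring)] at r
    linear_combination l - r - h1
  have e2 : t * ∫ v, stieltjes t v ^ 3 ∂P + (t + n - m) * ∫ v, stieltjes t v ^ 2 ∂P - m * T = κ := by
    have l := cubic 0 (-t) m 0
    have r := cubic t (n - m) 0 0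
    have r' := integral_add ik.neg (integrable_cubic i1 i2 i3 t (n - m) 0 0)
    rw [← integral_congr_ae (f := fun v : TensorSp m n =>
      stieltjes t v * (m - t * stieltjes t v)) (.of_forall fun v => by ring)] at l
    rw [← integral_congr_ae (f := fun v : TensorSp m n =>
      (-(∑ j, schmidtSq v j * (schmidtSq v j + t)⁻¹ ^ 3) +
        stieltjes t v * (n * stieltjes t v - stieltjes t v * (m - t * stieltjes t v))))
      (.of_forall fun v => by simp only [Pi.neg_apply]; ring)] at r'
    simp only [Pi.neg_apply, integral_neg] at r'
    linear_combination l - r - r' - h2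
  obtain ⟨G, rfl⟩ : ∃ G, g = t * G := ⟨g / t, by field_simp⟩
  have hG : 0 ≤ G := nonneg_of_mul_nonneg_right hg ht
  have hGt : t * G ^ 2 + (t + n - m) * G = m := by
    have := ht.ne'
    apply mul_left_cancel₀ this
    linarith
  set V := ∫ v, (stieltjes t v - G) ^ 2 ∂P with hV
  have hV0 : 0 ≤ V := integral_nonneg fun v => sq_nonneg _
  have hVe : V = ∫ v, stieltjes t v ^ 2 ∂P - 2 * G * T + G ^ 2 := by
    refine (integral_congr_ae (.of_forall fun v => ?_)).trans
      ((cubic 0 1 (-(2 * G)) (G ^ 2)).trans ?_)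
    · ring
    · ring
  have hab : t ≤ t * G + (t + n - m) := by linarith
  have hVκ : (t * G + (t + n - m)) * V ≤ κ := by
    have hle := integral_mono
      (integrable_cubic i1 i2 i3 0 (t * G + (t + n - m)) (-(2 * G * (t * G + (t + n - m))))
        (G ^ 2 * (t * G + (t + n - m))))
      (integrable_cubic i1 i2 i3 t (t + n - m - t * G) (-(m + (t + n - m) * G)) (m * G))
      fun v => ?_
    · rw [cubic, cubic] at hle
      rw [hVe]
      linear_combination hle + e2 - G * e1
    · have h0 := stieltjes_nonneg ht v
      have h3 : 0 ≤ t * stieltjes t v * (stieltjes t v - G) ^ 2 := by positivity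
      dsimp only
      linear_combination h3 - (stieltjes t v - G) * hGt
  have hmain : (2 * (t * G) + (t + n - m)) * (G - T) = t * V := by
    rw [hVe]
    linear_combination hGt - e1
  have hGT : 0 ≤ G - T := by
    have : 0 ≤ (2 * (t * G) + (t + n - m)) * (G - T) := hmain ▸ by positivity
    exact nonneg_of_mul_nonneg_right this (by linarith)
  have hT0 : 0 ≤ T := integral_nonneg fun v => stieltjes_nonneg ht v
  have hGm : t * G ≤ m := by linear_combination mul_le_mul_of_nonneg_right hab hG + hGt
  have hb1 : t ^ 2 * (t * (G - T)) ≤ m := by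
    have a1 : t * (G - T) ≤ (2 * (t * G) + (t + n - m)) * (G - T) := by
      gcongr
      linarith
    have a2 : t * V ≤ κ := le_trans (by gcongr) hVκ
    have a4 : t ^ 2 * κ ≤ m := by
      rw [le_div_iff₀ (by positivity)] at hκm
      linarith
    have a5 : t * (G - T) ≤ κ := a1.trans (hmain.trans_le a2)
    exact (mul_le_mul_of_nonneg_left a5 (sq_nonneg t)).trans a4
  have hb2 : t * (G - T) ≤ m := by linear_combination hGm + mul_nonneg ht.le hT0
  rw [show t * T - t * G = -(t * (G - T)) by ring, abs_neg, abs_of_nonneg (by positivity),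
    le_div_iff₀ (by positivity)]
  linarith

end StieltjesBound

section LogIntegral

open Set Topology

theorem tendsto_log_add_sub_log_add (a b : ℝ) :
    Tendsto (fun t : ℝ => Real.log (a + t) - Real.log (b + t)) atTop (𝓝 0) := by
  have ha : Tendsto (fun t : ℝ => (a + t) / (b + t)) atTop (𝓝 1) := by
    have h : Tendsto (fun t : ℝ => 1 + (a - b) / (b + t)) atTop (𝓝 (1 + 0)) :=
      tendsto_const_nhds.add (tendsto_const_nhds.div_atTop (tendsto_atTop_add_const_left _ _
        tendsto_id))
    rw [add_zero] at h
    refine h.congr' ?_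
    filter_upwards [eventually_gt_atTop (-b)] with t ht
    have : b + t ≠ 0 := by linarith
    field_simp
    ring
  have h := ha.log one_ne_zero
  rw [Real.log_one] at h
  refine h.congr' ?_
  filter_upwards [eventually_gt_atTop (-b), eventually_gt_atTop (-a)] with t hb ha
  rw [Real.log_div (by linarith) (by linarith)]

theorem integral_div_sub_div {x a : ℝ} (hx : 0 ≤ x) (ha : 0 < a) :
    IntegrableOn (fun t => x / (a + t) - x / (x + t)) (Ioi 0) ∧
    ∫ t in Ioi 0, (x / (a + t) - x / (x + t)) = x * Real.log x - x * Real.log a := by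
  rcases hx.eq_or_lt with rfl | hx
  · simp
  have hd : ∀ t ∈ Ici (0 : ℝ), HasDerivAt (fun t => x * (Real.log (a + t) - Real.log (x + t)))
      (x / (a + t) - x / (x + t)) t := by
    intro t ht
    rw [mem_Ici] at ht
    have h1 := ((hasDerivAt_id t).const_add a).log (by simp; positivity)
    have h2 := ((hasDerivAt_id t).const_add x).log (by simp; positivity)
    refine ((h1.sub h2).const_mul x).congr_deriv ?_
    simp
    ring
  have hlim := (tendsto_log_add_sub_log_add a x).const_mul x
  rw [mul_zero] at hlim
  have hv : 0 - x * (Real.log (a + 0) - Real.log (x + 0)) =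
      x * Real.log x - x * Real.log a := by
    simp only [add_zero]
    ring
  rcases le_total x a with h | h
  · have hs : ∀ t ∈ Ioi (0 : ℝ), x / (a + t) - x / (x + t) ≤ 0 := fun t ht => by
      rw [mem_Ioi] at ht
      rw [sub_nonpos]
      gcongr
    exact ⟨integrableOn_Ioi_deriv_of_nonpos' hd hs hlim,
      (integral_Ioi_of_hasDerivAt_of_nonpos' hd hs hlim).trans hv⟩
  · have hs : ∀ t ∈ Ioi (0 : ℝ), 0 ≤ x / (a + t) - x / (x + t) := fun t ht => by
      rw [mem_Ioi] at ht
      rw [sub_nonneg]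
      gcongr
    exact ⟨integrableOn_Ioi_deriv_of_nonneg' hd hs hlim,
      (integral_Ioi_of_hasDerivAt_of_nonneg' hd hs hlim).trans hv⟩

theorem abs_div_sub_div_le {x a t : ℝ} (hx : 0 ≤ x) (ha : 1 ≤ a) (ht : 0 < t) :
    |x / (a + t) - x / (x + t)| ≤ (x + a) * (1 + x) * (1 + t ^ 2)⁻¹ := by
  have h1 : 0 < a + t := by linarith
  have h2 : 0 < x + t := by linarith
  have e : x / (a + t) - x / (x + t) = (x - a) * (x / ((a + t) * (x + t))) := by
    field_simp
    ring
  rw [e, abs_mul, abs_of_nonneg (a := x / _) (by positivity), mul_assoc]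
  have h3 : |x - a| ≤ x + a := abs_le.2 ⟨by linarith, by linarith⟩
  have h4 : x / ((a + t) * (x + t)) ≤ (1 + x) * (1 + t ^ 2)⁻¹ := by
    rw [← div_eq_mul_inv, div_le_div_iff₀ (by positivity) (by positivity)]
    have : (1 + t) * (x + t) ≤ (a + t) * (x + t) := by gcongr
    have h5 : x * (1 + t ^ 2) ≤ (1 + x) * ((1 + t) * (x + t)) := by
      have : 0 ≤ x * t ^ 2 := by positivity
      have : 0 ≤ x ^ 2 := by positivity
      have : 0 ≤ x * t := by positivity
      have : 0 ≤ x ^ 2 * t := by positivity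
      nlinarith
    exact h5.trans (by gcongr)
  have : 0 ≤ x / ((a + t) * (x + t)) := by positivity
  exact mul_le_mul h3 h4 this (by linarith)

/-- The mean-field value of `t` times the Stieltjes transform. -/
def meanStieltjes (m n t : ℝ) : ℝ := (√((t + n + m) ^ 2 - 4 * n * m) - (t + n - m)) / 2

theorem meanStieltjes_sq {m n t : ℝ} (hm : 0 ≤ m) (ht : 0 ≤ t) :
    meanStieltjes m n t ^ 2 + (t + n - m) * meanStieltjes m n t = m * t := by
  have h : 0 ≤ (t + n + m) ^ 2 - 4 * n * m := by
    have : (t + n + m) ^ 2 - 4 * n * m = (t + n - m) ^ 2 + 4 * (t * m) := by ring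
    rw [this]
    positivity
  unfold meanStieltjes
  linear_combination (1 / 4) * Real.sq_sqrt h

theorem meanStieltjes_nonneg {m n t : ℝ} (hm : 0 ≤ m) (ht : 0 ≤ t) :
    0 ≤ meanStieltjes m n t := by
  have h : t + n - m ≤ √((t + n + m) ^ 2 - 4 * n * m) := by
    refine Real.le_sqrt_of_sq_le ?_
    nlinarith [mul_nonneg ht hm]
  unfold meanStieltjes
  linarith

theorem integral_meanStieltjes {m n : ℝ} (hm : 0 < m) (hmn : m ≤ n) :
    IntegrableOn (fun t => n * m / (n + t) - m + meanStieltjes m n t) (Ioi 0) ∧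
    ∫ t in Ioi 0, (n * m / (n + t) - m + meanStieltjes m n t) = m ^ 2 / 2 := by
  have hn : 0 < n := hm.trans_le hmn
  set s : ℝ → ℝ := fun t => √((t + n + m) ^ 2 - 4 * n * m) with hs
  have hs0 : ∀ t, 0 ≤ s t := fun t => Real.sqrt_nonneg _
  have harg : ∀ t, 0 < t → 0 < (t + n + m) ^ 2 - 4 * n * m := fun t ht => by
    have : (t + n + m) ^ 2 - 4 * n * m = (t + n - m) ^ 2 + 4 * (t * m) := by ring
    rw [this]
    positivity
  have hsq : ∀ t, 0 < t → s t ^ 2 = (t + n + m) ^ 2 - 4 * n * m := fun t ht =>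
    Real.sq_sqrt (harg t ht).le
  set Φ : ℝ → ℝ := fun t => n * m * (Real.log (n + t) - Real.log (t + n + m + s t)) +
    (t + n + m) * (s t - (t + n + m)) / 4 with hΦ
  have hcont : ContinuousWithinAt Φ (Ici 0) 0 := by
    refine ContinuousAt.continuousWithinAt ?_
    have hsc : Continuous s := by fun_prop
    have h1 : n + 0 ≠ 0 := by linarith
    have h2 : 0 + n + m + s 0 ≠ 0 := by have := hs0 0; positivity
    fun_prop (disch := assumption)
  have hderiv : ∀ t ∈ Ioi (0 : ℝ),
      HasDerivAt Φ (n * m / (n + t) - m + meanStieltjes m n t) t := by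
    intro t ht
    rw [mem_Ioi] at ht
    have hspos : 0 < s t := Real.sqrt_pos.2 (harg t ht)
    have hu : HasDerivAt (fun t : ℝ => t + n + m) 1 t :=
      ((hasDerivAt_id t).add_const n).add_const m
    have hsd : HasDerivAt s ((t + n + m) / s t) t := by
      refine (((hu.pow 2).sub_const (4 * n * m)).sqrt (harg t ht).ne').congr_deriv ?_
      simp only [hs]
      field_simp
      simp
      ring
    have h1 := ((hasDerivAt_id t).const_add n).log (by simp; positivity)
    have h2 := (hu.add hsd).log (by simp; positivity)
    refine (((h1.sub h2).const_mul (n * m)).add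
      ((hu.mul (hsd.sub hu)).div_const 4)).congr_deriv ?_
    have hne : t + n + m + s t ≠ 0 := by positivity
    have hnt : n + t ≠ 0 := by positivity
    have e : meanStieltjes m n t = (s t - (t + n - m)) / 2 := rfl
    rw [e]
    have e2 : (1 + (t + n + m) / s t) / (t + n + m + s t) = 1 / s t := by
      field_simp
      ring
    simp only [id, Pi.add_apply, Pi.sub_apply, e2]
    field_simp
    linear_combination -2 * (n + t) * hsq t ht
  have hpos : ∀ t ∈ Ioi (0 : ℝ), 0 ≤ n * m / (n + t) - m + meanStieltjes m n t := by
    intro t ht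
    rw [mem_Ioi] at ht
    have hg := meanStieltjes_nonneg (n := n) hm.le ht.le
    have hq := meanStieltjes_sq (n := n) hm.le ht.le
    have e : n * m / (n + t) - m + meanStieltjes m n t =
        meanStieltjes m n t * (m - meanStieltjes m n t) / (n + t) := by
      have hnt : n + t ≠ 0 := by positivity
      field_simp
      linear_combination hq
    rw [e]
    have : meanStieltjes m n t ≤ m := by nlinarith
    have : 0 ≤ m - meanStieltjes m n t := by linarith
    positivity
  have hΦ0 : Φ 0 = -(n * m * Real.log 2) - m * (n + m) / 2 := by
    have h0 : s 0 = n - m := by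
      simp only [hs]
      rw [show (0 + n + m) ^ 2 - 4 * n * m = (n - m) ^ 2 by ring, Real.sqrt_sq (by linarith)]
    simp only [hΦ, h0]
    rw [show 0 + n + m + (n - m) = 2 * n by ring, Real.log_mul two_ne_zero hn.ne']
    simp only [add_zero]
    ring
  have hu : Tendsto (fun t : ℝ => t + n + m) atTop atTop :=
    tendsto_atTop_add_const_right _ _ (tendsto_atTop_add_const_right _ _ tendsto_id)
  have hus : Tendsto (fun t : ℝ => t + n + m + s t) atTop atTop :=
    tendsto_atTop_mono (fun t => by linarith [hs0 t]) hu
  have hw : Tendsto (fun t => s t - (t + n + m)) atTop (𝓝 0) := by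
    have : Tendsto (fun t => -(4 * n * m) / (t + n + m + s t)) atTop (𝓝 0) :=
      tendsto_const_nhds.div_atTop hus
    refine this.congr' ?_
    filter_upwards [eventually_gt_atTop 0] with t ht
    have hne : t + n + m + s t ≠ 0 := by have := hs0 t; positivity
    field_simp
    linear_combination -hsq t ht
  have hratio : Tendsto (fun t => (t + n + m + s t) / (t + n + m)) atTop (𝓝 2) := by
    have : Tendsto (fun t => 2 + (s t - (t + n + m)) / (t + n + m)) atTop (𝓝 (2 + 0)) :=
      tendsto_const_nhds.add (hw.div_atTop hu)
    rw [add_zero] at this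
    refine this.congr' ?_
    filter_upwards [eventually_gt_atTop 0] with t ht
    have hne : t + n + m ≠ 0 := by positivity
    field_simp
    ring
  have hlim : Tendsto Φ atTop (𝓝 (-(n * m * Real.log 2) - n * m / 2)) := by
    have h1 := (tendsto_log_add_sub_log_add n (n + m)).sub (hratio.log two_ne_zero)
    have h2 := (hratio.inv₀ two_ne_zero).const_mul (-(n * m))
    have h3 := (h1.const_mul (n * m)).add h2
    rw [show -(n * m * Real.log 2) - n * m / 2 = n * m * (0 - Real.log 2) + -(n * m) * 2⁻¹ by
      ring]
    refine h3.congr' ?_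
    filter_upwards [eventually_gt_atTop 0] with t ht
    have hne : t + n + m ≠ 0 := by positivity
    have hne2 : t + n + m + s t ≠ 0 := by have := hs0 t; positivity
    rw [Real.log_div hne2 hne, show n + m + t = t + n + m by ring]
    simp only [hΦ]
    field_simp
    linear_combination -(t + n + m) * hsq t ht
  refine ⟨integrableOn_Ioi_deriv_of_nonneg hcont hderiv hpos hlim,
    (integral_Ioi_of_hasDerivAt_of_nonneg hcont hderiv hpos hlim).trans ?_⟩
  rw [hΦ0]
  ring

end LogIntegral

section LogAverage

open Set

variable {m n : ℕ}

theorem sum_schmidtSq (v : TensorSp m n) : ∑ j, schmidtSq v j = ‖v‖ ^ 2 := by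
  have h := trace_redFun v id
  rw [redFun_id] at h
  have h2 : (redDensity v).trace = ((‖v‖ ^ 2 : ℝ) : ℂ) := by
    rw [EuclideanSpace.norm_sq_eq, Fintype.sum_prod_type]
    push_cast
    simp only [Matrix.trace, Matrix.diag, redDensity, Matrix.mul_apply,
      Matrix.conjTranspose_apply, coeffMatrix, Matrix.of_apply]
    refine Finset.sum_congr rfl fun i _ => Finset.sum_congr rfl fun j _ => ?_
    exact Complex.mul_conj' _
  rw [h2] at h
  exact_mod_cast h.symm

theorem schmidtSq_le (v : TensorSp m n) (j : Fin m) : schmidtSq v j ≤ ‖v‖ ^ 2 := by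
  rw [← sum_schmidtSq]
  exact Finset.single_le_sum (fun i _ => schmidtSq_nonneg v i) (Finset.mem_univ j)

theorem sum_schmidtSq_div_sub_div {t : ℝ} (ht : 0 < t) (v : TensorSp m n) :
    ∑ j, (schmidtSq v j / (n + t) - schmidtSq v j / (schmidtSq v j + t)) =
      ‖v‖ ^ 2 / (n + t) - m + t * stieltjes t v := by
  rw [Finset.sum_sub_distrib, ← Finset.sum_div, sum_schmidtSq]
  have : ∀ j, schmidtSq v j / (schmidtSq v j + t) = 1 - t * (schmidtSq v j + t)⁻¹ := by
    intro j
    have := schmidtSq_nonneg v j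
    have : schmidtSq v j + t ≠ 0 := by positivity
    field_simp
    ring
  simp only [this, Finset.sum_sub_distrib, ← Finset.mul_sum, stieltjes]
  simp
  ring

theorem integral_sum_schmidtSq_log (hn : 0 < n) (v : TensorSp m n) :
    ∫ t in Ioi (0 : ℝ), (‖v‖ ^ 2 / (n + t) - m + t * stieltjes t v) =
      ∑ j, schmidtSq v j * Real.log (schmidtSq v j) - ‖v‖ ^ 2 * Real.log n := by
  have hn' : (0 : ℝ) < n := by exact_mod_cast hn
  have h := fun j => integral_div_sub_div (schmidtSq_nonneg v j) hn'
  rw [← setIntegral_congr_fun measurableSet_Ioi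
    (fun t ht => sum_schmidtSq_div_sub_div (mem_Ioi.1 ht) v),
    integral_finsetSum _ fun j _ => (h j).1]
  simp only [(h _).2, Finset.sum_sub_distrib, ← Finset.sum_mul, sum_schmidtSq]

theorem abs_log_integrand_le (hn : 0 < n) {t : ℝ} (ht : 0 < t) (v : TensorSp m n) :
    |‖v‖ ^ 2 / (n + t) - m + t * stieltjes t v| ≤
      m * ((‖v‖ ^ 2 + n) * (1 + ‖v‖ ^ 2)) * (1 + t ^ 2)⁻¹ := by
  have hn' : (1 : ℝ) ≤ n := by exact_mod_cast hn
  rw [← sum_schmidtSq_div_sub_div ht]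
  refine (Finset.abs_sum_le_sum_abs _ _).trans ?_
  refine (Finset.sum_le_card_nsmul _ _ ((‖v‖ ^ 2 + n) * (1 + ‖v‖ ^ 2) * (1 + t ^ 2)⁻¹)
    fun j _ => ?_).trans_eq ?_
  · refine (abs_div_sub_div_le (schmidtSq_nonneg v j) hn' ht).trans ?_
    have h0 := schmidtSq_nonneg v j
    have h1 := schmidtSq_le v j
    gcongr
  · simp
    ring

theorem aestronglyMeasurable_log_integrand (hn : 0 < n) (P : Measure (TensorSp m n)) [SFinite P] :
    AEStronglyMeasurable (fun p : TensorSp m n × ℝ =>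
      ‖p.1‖ ^ 2 / (n + p.2) - m + p.2 * stieltjes p.2 p.1)
      (P.prod (volume.restrict (Ioi 0))) := by
  have hc : ContinuousOn (fun p : TensorSp m n × ℝ =>
      ‖p.1‖ ^ 2 / (n + p.2) - m + p.2 * (densityResolvent p.2 p.1).trace.re)
      (univ ×ˢ Ioi 0) := by
    intro p hp
    have hp2 : 0 < p.2 := hp.2
    have hn' : (n : ℝ) + p.2 ≠ 0 := by positivity
    have h1 : ContinuousAt (fun p : TensorSp m n × ℝ => (densityResolvent p.2 p.1).trace.re) p :=
      (Complex.continuous_re.comp continuous_id.matrix_trace).continuousAt.comp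
        (continuousAt_densityResolvent hp2)
    refine ContinuousAt.continuousWithinAt ?_
    fun_prop (disch := assumption)
  have hm : MeasurableSet (univ ×ˢ Ioi 0 : Set (TensorSp m n × ℝ)) :=
    MeasurableSet.univ.prod measurableSet_Ioi
  have e : P.prod (volume.restrict (Ioi (0 : ℝ))) =
      (P.prod volume).restrict (univ ×ˢ Ioi 0) := by
    rw [← Measure.prod_restrict, Measure.restrict_univ]
  rw [e]
  refine (hc.aestronglyMeasurable hm).congr ?_
  filter_upwards [ae_restrict_mem hm] with p hp
  rw [trace_densityResolvent hp.2, Complex.ofReal_re]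

variable [NeZero m] [NeZero n]

theorem integrable_log_integrand :
    Integrable (fun p : TensorSp m n × ℝ => ‖p.1‖ ^ 2 / (n + p.2) - m + p.2 * stieltjes p.2 p.1)
      ((gaussianProb (volume : Measure (TensorSp m n))).prod (volume.restrict (Ioi 0))) := by
  have hn : 0 < n := Nat.pos_of_neZero n
  have hb : Integrable (fun v : TensorSp m n => (m : ℝ) * ((‖v‖ ^ 2 + n) * (1 + ‖v‖ ^ 2)))
      (gaussianProb volume) := by
    refine integrable_gaussianProb_of_bound (C := m * (1 + n)) (k := 4) volume
      (by fun_prop) fun v => ?_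
    rw [Real.norm_of_nonneg (by positivity), mul_assoc]
    have h0 := norm_nonneg v
    have h1 : ‖v‖ ^ 2 + n ≤ (1 + n) * (1 + ‖v‖) ^ 2 := by
      have : (0 : ℝ) ≤ n * ‖v‖ := by positivity
      have : (0 : ℝ) ≤ n * ‖v‖ ^ 2 := by positivity
      nlinarith
    have h2 : 1 + ‖v‖ ^ 2 ≤ (1 + ‖v‖) ^ 2 := by nlinarith
    calc (m : ℝ) * ((‖v‖ ^ 2 + n) * (1 + ‖v‖ ^ 2))
        ≤ m * (((1 + n) * (1 + ‖v‖) ^ 2) * (1 + ‖v‖) ^ 2) := by gcongr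
      _ = m * ((1 + n) * (1 + ‖v‖) ^ 4) := by ring
  refine (hb.mul_prod (integrable_inv_one_add_sq.restrict (s := Ioi 0))).mono'
    (aestronglyMeasurable_log_integrand hn _) ?_
  have e : (gaussianProb (volume : Measure (TensorSp m n))).prod (volume.restrict (Ioi (0 : ℝ))) =
      ((gaussianProb (volume : Measure (TensorSp m n))).prod volume).restrict (univ ×ˢ Ioi 0) := by
    rw [← Measure.prod_restrict, Measure.restrict_univ]
  rw [e]
  filter_upwards [ae_restrict_mem (MeasurableSet.univ.prod measurableSet_Ioi)] with p hp
  rw [Real.norm_eq_abs]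
  exact abs_log_integrand_le hn hp.2 p.1

theorem integrable_sum_schmidtSq_log :
    Integrable (fun v : TensorSp m n =>
      ∑ j, schmidtSq v j * Real.log (schmidtSq v j) - ‖v‖ ^ 2 * Real.log n)
      (gaussianProb volume) := by
  have h := (integrable_log_integrand (m := m) (n := n)).integral_prod_left
  simpa only [integral_sum_schmidtSq_log (Nat.pos_of_neZero n)] using h

theorem integrable_norm_sq :
    Integrable (fun v : TensorSp m n => ‖v‖ ^ 2) (gaussianProb volume) := by
  refine integrable_gaussianProb_of_bound (C := 1) (k := 2) volume (by fun_prop) fun v => ?_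
  rw [Real.norm_of_nonneg (by positivity)]
  nlinarith [norm_nonneg v]

theorem abs_integral_sum_schmidtSq_log_sub_le (hmn : m ≤ n) :
    |∫ v : TensorSp m n, (∑ j, schmidtSq v j * Real.log (schmidtSq v j) -
      ‖v‖ ^ 2 * Real.log n) ∂(gaussianProb volume) - (m : ℝ) ^ 2 / 2| ≤ Real.pi * m := by
  have hn : 0 < n := Nat.pos_of_neZero n
  have hm : (0 : ℝ) < m := by exact_mod_cast Nat.pos_of_neZero m
  have hmn' : (m : ℝ) ≤ n := by exact_mod_cast hmn
  have hint := integrable_log_integrand (m := m) (n := n)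
  have hswap := integral_integral_swap (f := fun (v : TensorSp m n) (t : ℝ) =>
    ‖v‖ ^ 2 / (n + t) - m + t * stieltjes t v) hint
  simp only [integral_sum_schmidtSq_log hn] at hswap
  have hg := integral_meanStieltjes hm hmn'
  rw [hswap, ← hg.2, ← integral_sub hint.integral_prod_right hg.1, ← Real.norm_eq_abs]
  have hpi : ∫ t in Ioi (0 : ℝ), 2 * (m : ℝ) * (1 + t ^ 2)⁻¹ = Real.pi * m := by
    rw [integral_const_mul, integral_Ioi_inv_one_add_sq]
    simp
    ring
  rw [← hpi]
  refine norm_integral_le_of_norm_le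
    ((integrable_inv_one_add_sq.restrict (s := Ioi 0)).const_mul _) ?_
  filter_upwards [ae_restrict_mem measurableSet_Ioi] with t ht
  rw [mem_Ioi] at ht
  have hs : Integrable (fun v : TensorSp m n => t * stieltjes t v) (gaussianProb volume) := by
    simpa using (integrable_stieltjes_pow (m := m) (n := n) ht 1).const_mul t
  have he : ∫ v : TensorSp m n, (‖v‖ ^ 2 / (n + t) - m + t * stieltjes t v)
      ∂(gaussianProb volume) =
      n * m / (n + t) - m + t * ∫ v : TensorSp m n, stieltjes t v ∂(gaussianProb volume) := by
    have h1 := (integrable_norm_sq (m := m) (n := n)).div_const (n + t)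
    have h2 : Integrable (fun v : TensorSp m n => ‖v‖ ^ 2 / (n + t) - m) (gaussianProb volume) :=
      h1.sub (integrable_const _)
    rw [integral_add h2 hs, integral_sub h1 (integrable_const _),
      integral_div, integral_norm_sq, integral_const_mul]
    simp
    ring
  rw [he, Real.norm_eq_abs, show ∀ a b c : ℝ, a + b - (a + c) = b - c by intros; ring,
    ← div_eq_mul_inv]
  exact abs_integral_stieltjes_sub_le ht hmn (meanStieltjes_nonneg hm.le ht.le)
    (meanStieltjes_sq hm.le ht.le)

end LogAverage

section SphereAverage

variable {m n : ℕ}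

theorem roots_charpoly_redFun (v : TensorSp m n) (f : ℝ → ℝ) :
    (redFun v f).charpoly.roots =
      Finset.univ.val.map fun j => ((f (schmidtSq v j) : ℝ) : ℂ) := by
  unfold redFun
  rw [Matrix.charpoly_mul_comm, ← mul_assoc, Unitary.coe_star_mul_self, one_mul,
    Matrix.charpoly_diagonal, Polynomial.roots_prod _ _
      (Finset.prod_ne_zero_iff.2 fun j _ => Polynomial.X_sub_C_ne_zero _)]
  simp

theorem redDensity_smul (r : ℝ) (v : TensorSp m n) :
    redDensity (r • v) = redFun v fun x => r ^ 2 * x := by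
  have h : redFun v (fun _ => r ^ 2) * redFun v id = redFun v fun x => r ^ 2 * x :=
    redFun_mul v _ _
  rw [← h, redFun_const, redFun_id, Matrix.smul_mul, Matrix.one_mul]
  ext i j
  simp only [redDensity, coeffMatrix, Matrix.mul_apply, Matrix.conjTranspose_apply,
    Matrix.of_apply, PiLp.smul_apply, Complex.real_smul,
    Matrix.smul_apply, smul_eq_mul, Finset.mul_sum]
  refine Finset.sum_congr rfl fun k _ => ?_
  rw [star_mul', Complex.star_def, Complex.conj_ofReal]
  push_cast
  ring

theorem sum_schmidtSq_smul (r : ℝ) (v : TensorSp m n) (f : ℝ → ℝ) :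
    ∑ j, f (schmidtSq (r • v) j) = ∑ j, f (r ^ 2 * schmidtSq v j) := by
  have h1 := roots_charpoly_redFun v fun x => r ^ 2 * x
  rw [← redDensity_smul, (redDensity_isHermitian (r • v)).roots_charpoly_eq_eigenvalues] at h1
  have h2 := congrArg (fun s : Multiset ℂ => (s.map fun z => f z.re).sum) h1
  simp only [Multiset.map_map] at h2
  exact h2

theorem sum_mul_log_smul_sphere (θ : Metric.sphere (0 : TensorSp m n) 1) {r : ℝ} (hr : 0 < r) :
    ∑ j, schmidtSq (r • (θ : TensorSp m n)) j * Real.log (schmidtSq (r • (θ : TensorSp m n)) j) -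
      ‖r • (θ : TensorSp m n)‖ ^ 2 * Real.log (‖r • (θ : TensorSp m n)‖ ^ 2) =
      r ^ 2 * -entEntropy (θ : TensorSp m n) := by
  have hθ : ‖(θ : TensorSp m n)‖ = 1 := by simp
  have hs := sum_schmidtSq (θ : TensorSp m n)
  rw [hθ, one_pow] at hs
  have hl : ∀ p : ℝ, r ^ 2 * p * Real.log (r ^ 2 * p) =
      r ^ 2 * Real.log (r ^ 2) * p + r ^ 2 * (p * Real.log p) := by
    intro p
    rcases eq_or_ne p 0 with rfl | hp
    · simp
    · rw [Real.log_mul (by positivity) hp]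
      ring
  rw [sum_schmidtSq_smul r (θ : TensorSp m n) fun x => x * Real.log x]
  simp only [hl, Finset.sum_add_distrib, ← Finset.mul_sum, hs]
  rw [norm_smul, hθ, mul_one, Real.norm_of_nonneg hr.le, entEntropy]
  ring_nf

theorem add_sub_le_mul_log {x K : ℝ} (hx : 0 ≤ x) (hK : 0 < K) :
    x * Real.log K + x - K ≤ x * Real.log x := by
  rcases hx.eq_or_lt with rfl | hx
  · simp [hK.le]
  · have h := Real.log_le_sub_one_of_pos (div_pos hK hx)
    rw [Real.log_div hK.ne' hx.ne'] at h
    have h2 := mul_le_mul_of_nonneg_left h hx.le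
    have h3 : x * (K / x - 1) = K - x := by field_simp
    linarith

theorem mul_log_le_add {x K : ℝ} (hx : 0 ≤ x) (hK : 0 < K) :
    x * Real.log x ≤ x * Real.log K + (x ^ 2 / K - x) := by
  rcases hx.eq_or_lt with rfl | hx
  · simp
  · have h := Real.log_le_sub_one_of_pos (div_pos hx hK)
    rw [Real.log_div hx.ne' hK.ne'] at h
    have h2 := mul_le_mul_of_nonneg_left h hx.le
    have h3 : x * (x / K - 1) = x ^ 2 / K - x := by field_simp
    linarith

variable [NeZero m] [NeZero n]

theorem integrable_norm_pow_four :
    Integrable (fun v : TensorSp m n => (‖v‖ ^ 2) ^ 2) (gaussianProb volume) := by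
  refine integrable_gaussianProb_of_bound (C := 1) (k := 4) volume (by fun_prop) fun v => ?_
  rw [Real.norm_of_nonneg (by positivity), ← pow_mul, one_mul]
  exact pow_le_pow_left₀ (norm_nonneg v) (by linarith) 4

theorem integrable_norm_sq_mul_log :
    Integrable (fun v : TensorSp m n => ‖v‖ ^ 2 * Real.log (‖v‖ ^ 2)) (gaussianProb volume) := by
  have hc : Continuous fun v : TensorSp m n => ‖v‖ ^ 2 * Real.log (‖v‖ ^ 2) :=
    Real.continuous_mul_log.comp (by fun_prop : Continuous fun v : TensorSp m n => ‖v‖ ^ 2)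
  have h4 := integrable_norm_pow_four (m := m) (n := n)
  refine Integrable.mono' ((integrable_const 1).add h4) ?_ (.of_forall fun v => ?_)
  · exact hc.aestronglyMeasurable
  · have h1 := add_sub_le_mul_log (sq_nonneg ‖v‖) one_pos
    have h2 := mul_log_le_add (sq_nonneg ‖v‖) one_pos
    simp only [Real.log_one, mul_zero, zero_add, div_one] at h1 h2
    have h3 := sq_nonneg ‖v‖
    have h5 := sq_nonneg (‖v‖ ^ 2)
    rw [Real.norm_eq_abs]
    simp only [Pi.add_apply]
    exact abs_le.2 ⟨by linarith, by linarith⟩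

theorem integral_norm_sq_mul_log_mem :
    ∫ v : TensorSp m n, ‖v‖ ^ 2 * Real.log (‖v‖ ^ 2) ∂(gaussianProb volume) ∈
      Set.Icc ((m * n : ℝ) * Real.log (m * n)) (m * n * Real.log (m * n) + 1) := by
  have hm : (0 : ℝ) < m := by exact_mod_cast Nat.pos_of_neZero m
  have hn : (0 : ℝ) < n := by exact_mod_cast Nat.pos_of_neZero n
  have hK : (0 : ℝ) < m * n := by positivity
  have h1 := integrable_norm_sq (m := m) (n := n)
  have h2 := integrable_norm_pow_four (m := m) (n := n)
  have hl := integrable_norm_sq_mul_log (m := m) (n := n)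
  have e1 := integral_norm_sq (volume : Measure (TensorSp m n))
  have e2 := integral_norm_pow_four (volume : Measure (TensorSp m n))
  simp only [Fintype.card_prod, Fintype.card_fin, Nat.cast_mul] at e1 e2
  have hL : Integrable (fun v : TensorSp m n => ‖v‖ ^ 2 * Real.log (m * n) + ‖v‖ ^ 2)
      (gaussianProb volume) := (h1.mul_const _).add h1
  have hU : Integrable (fun v : TensorSp m n => (‖v‖ ^ 2) ^ 2 / (m * n : ℝ) - ‖v‖ ^ 2)
      (gaussianProb volume) := (h2.div_const _).sub h1
  constructor
  · have h := integral_mono (hL.sub (integrable_const (m * n : ℝ))) hl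
      fun v => add_sub_le_mul_log (sq_nonneg ‖v‖) hK
    simp only [Pi.sub_apply] at h
    rw [integral_sub hL (integrable_const _), integral_add (h1.mul_const _) h1,
      integral_mul_const, e1] at h
    simp only [integral_const, probReal_univ, one_smul] at h
    linarith
  · have h := integral_mono hl ((h1.mul_const (Real.log (m * n))).add hU)
      fun v => mul_log_le_add (sq_nonneg ‖v‖) hK
    simp only [Pi.add_apply] at h
    rw [integral_add (h1.mul_const _) hU, integral_sub (h2.div_const _) h1,
      integral_mul_const, integral_div, e1, e2, mul_div_cancel_left₀ _ hK.ne'] at h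
    linarith

theorem abs_integral_entEntropy_sub_le (hmn : m ≤ n) :
    |∫ v, entEntropy (v : TensorSp m n) ∂(sphereUniform m n) -
      (Real.log m - m / (2 * n))| ≤ 5 / n := by
  have hm : (1 : ℝ) ≤ m := by exact_mod_cast Nat.pos_of_neZero m
  have hn : (0 : ℝ) < n := by exact_mod_cast Nat.pos_of_neZero n
  have hhom := integral_gaussianProb_homogeneous (volume : Measure (TensorSp m n))
    (fun θ => -entEntropy (θ : TensorSp m n))
    (fun v => ∑ j, schmidtSq v j * Real.log (schmidtSq v j) - ‖v‖ ^ 2 * Real.log (‖v‖ ^ 2))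
    fun θ r hr => sum_mul_log_smul_sphere θ hr
  have e1 := integral_norm_sq (volume : Measure (TensorSp m n))
  simp only [Fintype.card_prod, Fintype.card_fin, Nat.cast_mul] at e1
  have h1 := integrable_norm_sq (m := m) (n := n)
  have hX := integrable_sum_schmidtSq_log (m := m) (n := n)
  have hl := integrable_norm_sq_mul_log (m := m) (n := n)
  have hsplit : ∫ v : TensorSp m n, (∑ j, schmidtSq v j * Real.log (schmidtSq v j) -
      ‖v‖ ^ 2 * Real.log (‖v‖ ^ 2)) ∂(gaussianProb volume) =
      ∫ v : TensorSp m n, (∑ j, schmidtSq v j * Real.log (schmidtSq v j) -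
        ‖v‖ ^ 2 * Real.log n) ∂(gaussianProb volume) +
      m * n * Real.log n -
      ∫ v : TensorSp m n, ‖v‖ ^ 2 * Real.log (‖v‖ ^ 2) ∂(gaussianProb volume) := by
    have hXl : Integrable (fun v : TensorSp m n =>
        (∑ j, schmidtSq v j * Real.log (schmidtSq v j) - ‖v‖ ^ 2 * Real.log n) +
          ‖v‖ ^ 2 * Real.log n) (gaussianProb volume) := hX.add (h1.mul_const _)
    rw [← e1, ← integral_mul_const, ← integral_add hX (h1.mul_const _), ← integral_sub hXl hl]
    simp
  have hS : ∫ θ : Metric.sphere (0 : TensorSp m n) 1, -entEntropy (θ : TensorSp m n)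
      ∂((volume : Measure (TensorSp m n)).toSphere Set.univ)⁻¹ •
        (volume : Measure (TensorSp m n)).toSphere =
      -∫ v, entEntropy (v : TensorSp m n) ∂(sphereUniform m n) := integral_neg _
  rw [hsplit, hS, e1] at hhom
  have hb := abs_le.1 (abs_integral_sum_schmidtSq_log_sub_le (m := m) (n := n) hmn)
  obtain ⟨hY1, hY2⟩ := integral_norm_sq_mul_log_mem (m := m) (n := n)
  rw [Real.log_mul (by positivity) hn.ne'] at hY1 hY2
  have hpi : Real.pi * m ≤ 4 * m := by
    have := Real.pi_le_four
    gcongr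
  generalize ∫ v, entEntropy (v : TensorSp m n) ∂(sphereUniform m n) = E at hhom ⊢
  generalize ∫ v : TensorSp m n, ‖v‖ ^ 2 * Real.log (‖v‖ ^ 2) ∂(gaussianProb volume) = Y
    at hhom hY1 hY2
  generalize ∫ v : TensorSp m n, (∑ j, schmidtSq v j * Real.log (schmidtSq v j) -
    ‖v‖ ^ 2 * Real.log n) ∂(gaussianProb volume) = X at hhom hb
  have e : E - (Real.log m - m / (2 * n)) =
      ((Y - m * n * (Real.log m + Real.log n)) - (X - (m : ℝ) ^ 2 / 2)) / (m * n) := by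
    field_simp
    linear_combination 2 * hhom
  rw [e, abs_div, abs_of_pos (a := (m * n : ℝ)) (by positivity),
    show (5 : ℝ) / n = (5 * m) / (m * n) by field_simp]
  gcongr
  exact abs_le.2 ⟨by linarith, by linarith⟩

end SphereAverage

section Asymptotics

open Topology

theorem isBigO_div_pow_sub {d : ℕ} (hd : 1 ≤ d) {c : ℝ} {m : ℕ → ℕ}
    (hm : (fun N : ℕ => (m N : ℝ) - c * (N : ℝ) ^ d) =O[atTop] fun N : ℕ => (N : ℝ) ^ (d - 1)) :
    (fun N : ℕ => (m N : ℝ) / (N : ℝ) ^ d - c) =O[atTop] fun N : ℕ => 1 / (N : ℝ) := by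
  have h := hm.mul (isBigO_refl (fun N : ℕ => ((N : ℝ) ^ d)⁻¹) atTop)
  obtain ⟨k, rfl⟩ := Nat.exists_eq_add_of_le' hd
  refine h.congr' ?_ ?_ <;> filter_upwards [eventually_gt_atTop 0] with N hN
  · have : (N : ℝ) ≠ 0 := by exact_mod_cast hN.ne'
    field_simp
  · have : (N : ℝ) ≠ 0 := by exact_mod_cast hN.ne'
    rw [Nat.add_sub_cancel]
    field_simp
    ring

theorem tendsto_of_isBigO_sub_one_div {x : ℕ → ℝ} {c : ℝ}
    (h : (fun N => x N - c) =O[atTop] fun N : ℕ => 1 / (N : ℝ)) : Tendsto x atTop (𝓝 c) :=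
  tendsto_sub_nhds_zero_iff.1 (h.trans_tendsto tendsto_one_div_atTop_nhds_zero_nat)

end Asymptotics

/-- Let `d ≥ 1`, `c₁, c₂ > 0`, and let `m, n : ℕ → ℕ` be
sequences of positive integers with `m N ≤ n N` for all large `N`,
`m N = c₁ N^d + O(N^{d−1})` and `n N = c₂ N^d + O(N^{d−1})`.  Then the average
entanglement entropy of pure states in `ℂ^{m N} ⊗ ℂ^{n N}` satisfies
`⟨E_N⟩ = d ln N + ln c₁ − c₁/(2c₂) + O(1/N)` as `N → ∞`. -/
theorem average_entropy_asymptotics_equal_dims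
    (d : ℕ) (hd : 1 ≤ d) (c₁ c₂ : ℝ) (hc₁ : 0 < c₁) (hc₂ : 0 < c₂)
    (m n : ℕ → ℕ) (hmpos : ∀ N, 0 < m N) (hnpos : ∀ N, 0 < n N)
    (hmn : ∀ᶠ N in atTop, m N ≤ n N)
    (hm : (fun N : ℕ => (m N : ℝ) - c₁ * (N : ℝ) ^ d)
        =O[atTop] fun N : ℕ => (N : ℝ) ^ (d - 1))
    (hn : (fun N : ℕ => (n N : ℝ) - c₂ * (N : ℝ) ^ d)
        =O[atTop] fun N : ℕ => (N : ℝ) ^ (d - 1)) :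
    (fun N : ℕ =>
        (∫ v, entEntropy (v : TensorSp (m N) (n N)) ∂(sphereUniform (m N) (n N))) -
          (d * Real.log N + Real.log c₁ - c₁ / (2 * c₂)))
      =O[atTop] fun N : ℕ => 1 / (N : ℝ) := by
  have hx := isBigO_div_pow_sub hd hm
  have hy := isBigO_div_pow_sub hd hn
  have hxt := tendsto_of_isBigO_sub_one_div hx
  have hyt := tendsto_of_isBigO_sub_one_div hy
  have hlog : (fun N : ℕ => Real.log ((m N : ℝ) / (N : ℝ) ^ d) - Real.log c₁)
      =O[atTop] fun N : ℕ => 1 / (N : ℝ) :=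
    ((Real.hasDerivAt_log hc₁.ne').isBigO_sub.comp_tendsto hxt).trans hx
  have hyinv : (fun N : ℕ => ((n N : ℝ) / (N : ℝ) ^ d)⁻¹) =O[atTop] fun _ => (1 : ℝ) :=
    (hyt.inv₀ hc₂.ne').isBigO_one ℝ
  have hratio : (fun N : ℕ => (m N : ℝ) / (2 * n N) - c₁ / (2 * c₂))
      =O[atTop] fun N : ℕ => 1 / (N : ℝ) := by
    have h := (((hx.const_mul_left (1 / 2)).sub (hy.const_mul_left (c₁ / (2 * c₂)))).mul hyinv)
    simp only [mul_one] at h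
    refine h.congr' ?_ .rfl
    filter_upwards [eventually_gt_atTop 0] with N hN
    have : (N : ℝ) ≠ 0 := by exact_mod_cast hN.ne'
    have : (n N : ℝ) ≠ 0 := by exact_mod_cast (hnpos N).ne'
    field_simp
    ring
  have hinv : (fun N : ℕ => 5 / (n N : ℝ)) =O[atTop] fun N : ℕ => 1 / (N : ℝ) := by
    have hpow : (fun N : ℕ => 1 / (N : ℝ) ^ d) =O[atTop] fun N : ℕ => 1 / (N : ℝ) := by
      refine IsBigO.of_bound' ?_
      filter_upwards [eventually_ge_atTop 1] with N hN
      have hN' : (1 : ℝ) ≤ N := by exact_mod_cast hN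
      rw [Real.norm_of_nonneg (by positivity), Real.norm_of_nonneg (by positivity)]
      exact one_div_le_one_div_of_le (by positivity) (le_self_pow₀ hN' (by omega))
    have h := (hpow.const_mul_left 5).mul hyinv
    simp only [mul_one] at h
    refine h.congr' ?_ .rfl
    filter_upwards [eventually_gt_atTop 0] with N hN
    have : (N : ℝ) ≠ 0 := by exact_mod_cast hN.ne'
    have : (n N : ℝ) ≠ 0 := by exact_mod_cast (hnpos N).ne'
    field_simp
  have hE : (fun N : ℕ =>
      (∫ v, entEntropy (v : TensorSp (m N) (n N)) ∂(sphereUniform (m N) (n N))) -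
        (Real.log (m N) - m N / (2 * n N))) =O[atTop] fun N : ℕ => 1 / (N : ℝ) := by
    refine (IsBigO.of_bound' ?_).trans hinv
    filter_upwards [hmn] with N hN
    have : NeZero (m N) := ⟨(hmpos N).ne'⟩
    have : NeZero (n N) := ⟨(hnpos N).ne'⟩
    rw [Real.norm_eq_abs, Real.norm_of_nonneg (by positivity)]
    exact abs_integral_entEntropy_sub_le hN
  refine ((hE.add hlog).sub hratio).congr' ?_ .rfl
  filter_upwards [eventually_gt_atTop 0] with N hN
  have hN' : (N : ℝ) ≠ 0 := by exact_mod_cast hN.ne'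
  have hm' : (m N : ℝ) ≠ 0 := by exact_mod_cast (hmpos N).ne'
  rw [Real.log_div hm' (pow_ne_zero d hN'), Real.log_pow]
  ring
end
end

section
/- Let 1 ≤ m ≤ n be integers and let F_m = {(x_1,…,x_m) ∈ ℝ^m : x_j ≥ 0 for all j and x_1+…+x_m = 1}. Then [∫_{F_m} (−Σ_{j=1}^m q_j ln q_j) · Π_{1≤j<k≤m}(q_k − q_j)² · Π_{j=1}^m q_j^{n−m} dq_1…dq_{m−1}] / [∫_{F_m} Π_{1≤j<k≤m}(q_k − q_j)² · Π_{j=1}^m q_j^{n−m} dq_1…dq_{m−1}] = Σ_{k=n+1}^{mn} 1/k − (m−1)/(2n), where on F_m one sets q_m = 1 − q_1 − … − q_{m−1} and integrates with respect to Lebesgue measure in (q_1,…,q_{m−1}). -/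
open MeasureTheory

noncomputable section

/-- The parameter domain for the probability simplex `F_m`, consisting of the
first `m−1` coordinates: `q_j ≥ 0` with `q_1 + … + q_{m−1} ≤ 1`
(so that `q_m = 1 − ∑_{j<m} q_j ≥ 0`). -/
def simplexDom (m : ℕ) : Set (Fin (m - 1) → ℝ) :=
  {q | (∀ j, 0 ≤ q j) ∧ ∑ j, q j ≤ 1}

/-- The point of the probability simplex `F_m ⊆ ℝ^m` parametrized by its first
`m−1` coordinates, with the last coordinate `q_m = 1 − ∑_{j<m} q_j`. -/
def simplexExt (m : ℕ) (q : Fin (m - 1) → ℝ) : Fin m → ℝ :=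
  fun i => if h : (i : ℕ) < m - 1 then q ⟨i, h⟩ else 1 - ∑ j, q j

theorem sum_det_updateRow_eq_trace {m : ℕ} (A B : Matrix (Fin m) (Fin m) ℝ) :
    ∑ i, (A.updateRow i (B i)).det = (B * A.adjugate).trace := by
  simp only [Matrix.trace, Matrix.diag_apply, Matrix.mul_apply]
  refine Finset.sum_congr rfl fun i _ => ?_
  rw [← Matrix.cramer_transpose_apply, Matrix.cramer_eq_adjugate_mulVec, ← Matrix.adjugate_transpose,
    Matrix.mulVec_eq_sum, Finset.sum_apply]
  simp [mul_comm]

theorem sum_perm_sum_perm_updateRow {m : ℕ} (A B : Matrix (Fin m) (Fin m) ℝ) :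
    ∑ i, ∑ σ : Equiv.Perm (Fin m), ∑ τ : Equiv.Perm (Fin m),
      ((σ.sign : ℤ) : ℝ) * ((τ.sign : ℤ) : ℝ) *
        ∏ j, (if j = i then B (σ j) (τ j) else A (σ j) (τ j)) =
    (m.factorial : ℝ) * ∑ i, (A.updateRow i (B i)).det := by
  have key (i : Fin m) (σ : Equiv.Perm (Fin m)) :
      ∑ τ : Equiv.Perm (Fin m), ((σ.sign : ℤ) : ℝ) * ((τ.sign : ℤ) : ℝ) *
        ∏ j, (if j = i then B (σ j) (τ j) else A (σ j) (τ j)) =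
      (A.updateRow (σ i) (B (σ i))).det := by
    have h := Matrix.det_permute σ (A.updateRow (σ i) (B (σ i)))
    rw [← Matrix.det_transpose, Matrix.det_apply'] at h
    have hs : ((σ.sign : ℤ) : ℝ) * ((σ.sign : ℤ) : ℝ) = 1 := by
      exact_mod_cast Int.units_coe_mul_self σ.sign
    calc _ = ((σ.sign : ℤ) : ℝ) * ∑ τ : Equiv.Perm (Fin m), ((τ.sign : ℤ) : ℝ) *
          ∏ j, (if j = i then B (σ j) (τ j) else A (σ j) (τ j)) := by
          rw [Finset.mul_sum]; simp only [mul_assoc]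
      _ = ((σ.sign : ℤ) : ℝ) * (((σ.sign : ℤ) : ℝ) * (A.updateRow (σ i) (B (σ i))).det) := by
          rw [← h]
          congr 1
          refine Finset.sum_congr rfl fun τ _ => ?_
          congr 1
          refine Finset.prod_congr rfl fun j _ => ?_
          simp only [Matrix.transpose_apply, Matrix.submatrix_apply, id, Matrix.updateRow_apply,
            EmbeddingLike.apply_eq_iff_eq]
          split_ifs with hj <;> simp [hj]
      _ = _ := by rw [← mul_assoc, hs, one_mul]
  simp only [key]
  rw [Finset.sum_comm]
  have h2 (σ : Equiv.Perm (Fin m)) : ∑ i, (A.updateRow (σ i) (B (σ i))).det =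
      ∑ i, (A.updateRow i (B i)).det :=
    Equiv.sum_comp σ fun i => (A.updateRow i (B i)).det
  simp [h2, Fintype.card_perm]

theorem sum_perm_sum_perm {m : ℕ} (A : Matrix (Fin m) (Fin m) ℝ) :
    ∑ σ : Equiv.Perm (Fin m), ∑ τ : Equiv.Perm (Fin m),
      ((σ.sign : ℤ) : ℝ) * ((τ.sign : ℤ) : ℝ) * ∏ j, A (σ j) (τ j) =
    (m.factorial : ℝ) * A.det := by
  rcases m with _ | m
  · simp
  · have h := sum_perm_sum_perm_updateRow A A
    simp only [ite_self, Matrix.updateRow_eq_self, Finset.sum_const, Finset.card_univ,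
      Fintype.card_fin, nsmul_eq_mul] at h
    have h3 : ((m + 1 : ℕ) : ℝ) ≠ 0 := by positivity
    apply mul_left_cancel₀ h3
    linarith

theorem trace_mul_adjugate_of_congr_diagonal {m : ℕ} (A B T : Matrix (Fin m) (Fin m) ℝ)
    (h : Fin m → ℝ) (hh : ∀ k, h k ≠ 0) (hT : T * A * T.transpose = Matrix.diagonal h) :
    A.det ≠ 0 ∧
    (B * A.adjugate).trace = A.det * ∑ k, (T * B * T.transpose) k k / h k := by
  have hdet : T.det * A.det * T.det = ∏ k, h k := by
    simpa [Matrix.det_mul] using congrArg Matrix.det hT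
  have hne : T.det * A.det * T.det ≠ 0 := hdet ▸ Finset.prod_ne_zero_iff.2 fun k _ => hh k
  have hTd : T.det ≠ 0 := right_ne_zero_of_mul hne
  have hAd : A.det ≠ 0 := right_ne_zero_of_mul (left_ne_zero_of_mul hne)
  refine ⟨hAd, ?_⟩
  set X := T.transpose * Matrix.diagonal (fun k => (h k)⁻¹) * T with hX
  have hAX : A * X = 1 := by
    have hTA : T * (A * X) = T * 1 := by
      calc T * (A * X) = (T * A * T.transpose) * Matrix.diagonal (fun k => (h k)⁻¹) * T := by
            simp only [hX, Matrix.mul_assoc]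
        _ = T * 1 := by
            rw [hT, Matrix.diagonal_mul_diagonal]
            simp [hh]
    have hu : IsUnit T := (Matrix.isUnit_iff_isUnit_det T).2 (Ne.isUnit hTd)
    exact hu.mul_left_cancel hTA
  have hadj : A.adjugate = A.det • X := by
    calc A.adjugate = A.adjugate * (A * X) := by rw [hAX, Matrix.mul_one]
      _ = A.det • X := by rw [← Matrix.mul_assoc, Matrix.adjugate_mul]; simp
  rw [hadj, Matrix.mul_smul, Matrix.trace_smul, smul_eq_mul]
  congr 1
  rw [hX, ← Matrix.mul_assoc, Matrix.trace_mul_comm, ← Matrix.mul_assoc, ← Matrix.mul_assoc,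
    Matrix.trace]
  simp [Matrix.mul_diagonal, div_eq_mul_inv]

theorem fwdDiff_iter_factorial_div (k n c : ℕ) :
    (fwdDiff 1)^[k] (fun n : ℕ => ((n + c).factorial : ℝ) / n.factorial) n =
      (c.descFactorial k : ℝ) * (n + c).factorial / (n + k).factorial := by
  rw [← descPochhammer_eval_eq_descFactorial]
  induction k generalizing n with
  | zero => simp
  | succ k ih =>
    rw [Function.iterate_succ_apply', fwdDiff, ih, ih, descPochhammer_succ_right,
      show n + 1 + c = n + c + 1 by ring, show n + 1 + k = n + k + 1 by ring, ← add_assoc,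
      Nat.factorial_succ, Nat.factorial_succ]
    have := Nat.factorial_ne_zero (n + k)
    simp
    field_simp
    ring

theorem fwdDiff_iter_factorial_mul_harmonic_div (C : ℝ) (k n c : ℕ) :
    (fwdDiff 1)^[k]
        (fun n : ℕ => ((n + c).factorial : ℝ) * (harmonic (n + c) + C) / n.factorial) n =
      ((descPochhammer ℝ k).derivative.eval (c : ℝ) +
        (c.descFactorial k : ℝ) * (harmonic (n + c) + C)) *
          (n + c).factorial / (n + k).factorial := by
  rw [← descPochhammer_eval_eq_descFactorial]
  induction k generalizing n with
  | zero => simp; ring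
  | succ k ih =>
    rw [Function.iterate_succ_apply', fwdDiff, ih, ih, descPochhammer_succ_right,
      show n + 1 + c = n + c + 1 by ring, show n + 1 + k = n + k + 1 by ring, ← add_assoc,
      Nat.factorial_succ, Nat.factorial_succ, harmonic_succ]
    have := Nat.factorial_ne_zero (n + k)
    have h1 : ((n : ℝ) + c + 1) ≠ 0 := by positivity
    simp
    field_simp
    ring

theorem derivative_descPochhammer_eval_of_le (k r : ℕ) :
    (descPochhammer ℝ k).derivative.eval ((r + k : ℕ) : ℝ) =
      ((r + k).factorial : ℝ) / r.factorial * (harmonic (r + k) - harmonic r) := by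
  induction k generalizing r with
  | zero => simp
  | succ k ih =>
    have h0 : (descPochhammer ℝ k).eval ((r + 1 + k : ℕ) : ℝ) =
        ((r + 1 + k).factorial : ℝ) / (r + 1).factorial := by
      rw [descPochhammer_eval_eq_descFactorial, Nat.descFactorial_eq_div (by omega)]
      rw [Nat.cast_div (Nat.factorial_dvd_factorial (by omega)) (by positivity)]
      simp
    have := ih (r + 1)
    rw [show r + (k + 1) = r + 1 + k by ring, descPochhammer_succ_right, Polynomial.derivative_mul,
      Polynomial.eval_add, Polynomial.eval_mul, Polynomial.eval_mul, this, h0,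
      Nat.factorial_succ r, harmonic_succ r]
    have := Nat.factorial_ne_zero r
    have h1 : ((r : ℝ) + 1) ≠ 0 := by positivity
    simp
    field_simp
    ring

theorem derivative_descPochhammer_eval_of_lt (c r : ℕ) :
    (descPochhammer ℝ (c + 1 + r)).derivative.eval (c : ℝ) =
      (-1) ^ r * c.factorial * r.factorial := by
  induction r with
  | zero =>
    have h := derivative_descPochhammer_eval_of_le c 0
    rw [zero_add] at h
    simp [descPochhammer_succ_right, descPochhammer_eval_eq_descFactorial, Nat.descFactorial_self]
  | succ r ih =>
    rw [← add_assoc, descPochhammer_succ_right, Polynomial.derivative_mul,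
      Polynomial.eval_add, Polynomial.eval_mul, Polynomial.eval_mul, ih,
      descPochhammer_eval_eq_descFactorial, Nat.descFactorial_of_lt (by omega),
      Nat.factorial_succ]
    simp
    ring

theorem sum_range_mul_div_eq_harmonic (x y : ℝ) (R : ℕ) :
    ∑ r ∈ Finset.range R, (x - r) * (y - r) / ((r + 1) * (r + 2)) =
      R + (x + 1) * (y + 1) * harmonic R - (x + 2) * (y + 2) * (harmonic (R + 1) - 1) := by
  induction R with
  | zero => simp
  | succ R ih =>
    rw [Finset.sum_range_succ, ih, harmonic_succ (R + 1), harmonic_succ R]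
    push_cast
    field_simp
    ring

theorem sum_choose_mul_derivative_descPochhammer (a k : ℕ) (C : ℝ) :
    ∑ q ∈ Finset.range (k + 1), (-1) ^ (k - q) * (k.choose q : ℝ) * ((q + a + 1 : ℝ) *
      ((descPochhammer ℝ k).derivative.eval ((q + 1 : ℕ) : ℝ) +
        ((q + 1).descFactorial k : ℝ) * (harmonic (a + (q + 1)) + C))) =
    k.factorial * ((2 * k + a + 1) * (harmonic (k + a) + C) + 2 * k + 1) := by
  rcases k with _ | K
  · simp [harmonic_succ]
    field_simp
    ring
  have hrest : ∑ q ∈ Finset.range K, (-1) ^ (K + 1 - q) * ((K + 1).choose q : ℝ) *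
      ((q + a + 1 : ℝ) * ((descPochhammer ℝ (K + 1)).derivative.eval ((q + 1 : ℕ) : ℝ) +
        ((q + 1).descFactorial (K + 1) : ℝ) * (harmonic (a + (q + 1)) + C))) =
      (K + 1).factorial *
        ∑ r ∈ Finset.range K, ((a + K : ℝ) - r) * ((K : ℝ) - r) / ((r + 1) * (r + 2)) := by
    rw [← Finset.sum_range_reflect, Finset.mul_sum]
    refine Finset.sum_congr rfl fun r hr => ?_
    obtain ⟨q, rfl⟩ : ∃ q, K = q + 1 + r :=
      ⟨K - 1 - r, by have := Finset.mem_range.1 hr; omega⟩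
    have e1 : q + 1 + r - 1 - r = q := by omega
    have e2 : q + 1 + r + 1 - q = r + 2 := by omega
    have e3 : q + 1 + r + 1 = q + 1 + 1 + r := by ring
    rw [e1, e2, Nat.descFactorial_of_lt (by omega), e3, derivative_descPochhammer_eval_of_lt]
    have hc := Nat.add_choose_mul_factorial_mul_factorial (r + 2) q
    rw [show r + 2 + q = q + 1 + 1 + r by ring] at hc
    have hc' : ((q + 1 + 1 + r).factorial : ℝ) =
        (q + 1 + 1 + r).choose q * q.factorial * ((r + 2) * ((r + 1) * r.factorial)) := by
      rw [← hc]
      push_cast [Nat.factorial_succ]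
      ring
    have hsign : ((-1 : ℝ) ^ (r + 2)) * (-1) ^ r = 1 := by
      rw [← pow_add, show r + 2 + r = 2 * (r + 1) by ring, pow_mul]
      simp
    have h1 : ((r : ℝ) + 1) ≠ 0 := by positivity
    have h2 : ((r : ℝ) + 2) ≠ 0 := by positivity
    rw [hc', Nat.factorial_succ q]
    push_cast
    field_simp
    linear_combination
      (((q + 1 + 1 + r).choose q : ℝ) * (q + a + 1) * (q + 1) * q.factorial * r.factorial) * hsign
  rw [Finset.sum_range_succ, Finset.sum_range_succ, hrest, sum_range_mul_div_eq_harmonic]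
  have hd0 := derivative_descPochhammer_eval_of_le (K + 1) 0
  have hd1 := derivative_descPochhammer_eval_of_le (K + 1) 1
  rw [zero_add] at hd0
  rw [show 1 + (K + 1) = K + 1 + 1 by ring] at hd1
  have hf : (K + 1 + 1).descFactorial (K + 1) = (K + 1 + 1).factorial := by
    rw [Nat.descFactorial_eq_div (by omega)]
    simp
  rw [hd0, hd1, hf, Nat.descFactorial_self, show a + (K + 1 + 1) = K + 1 + a + 1 by ring,
    show a + (K + 1) = K + 1 + a by ring, harmonic_succ (K + 1 + a), harmonic_succ (K + 1),
    harmonic_succ K, Nat.factorial_succ (K + 1)]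
  have h1 : ((K : ℝ) + 1 + a + 1) ≠ 0 := by positivity
  simp
  field_simp
  ring

/-- Row `k` holds the coefficients of the Laguerre polynomial of degree `k` and parameter `a`,
up to a scalar depending on `k`. -/
def laguerreMatrix (a m : ℕ) : Matrix (Fin m) (Fin m) ℝ :=
  Matrix.of fun k j => (-1) ^ ((k : ℕ) - j) * ((k : ℕ).choose j : ℝ) / ((a + j).factorial : ℝ)

theorem sum_fin_choose_eq_sum_range {m : ℕ} (k : Fin m) (f : ℕ → ℝ) :
    ∑ j : Fin m, (-1) ^ ((k : ℕ) - j) * ((k : ℕ).choose j : ℝ) * f j =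
      ∑ j ∈ Finset.range (k + 1), (-1) ^ ((k : ℕ) - j) * ((k : ℕ).choose j : ℝ) * f j := by
  rw [Fin.sum_univ_eq_sum_range
    (fun j => (-1) ^ ((k : ℕ) - j) * ((k : ℕ).choose j : ℝ) * f j) m]
  symm
  refine Finset.sum_subset (by simp) fun j _ hj => ?_
  rw [Nat.choose_eq_zero_of_lt (by simpa using hj)]
  simp

theorem sum_fin_choose_eq_fwdDiff {m : ℕ} (a : ℕ) (k : Fin m) (f : ℕ → ℝ) :
    ∑ j : Fin m, (-1) ^ ((k : ℕ) - j) * ((k : ℕ).choose j : ℝ) * f (a + j) =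
      (fwdDiff 1)^[k] f a := by
  rw [sum_fin_choose_eq_sum_range k fun j => f (a + j), fwdDiff_iter_eq_sum_shift]
  simp

/-- The Gram matrix of the monomials for the weight `x ^ a * exp (-x)` on the half-line. -/
def factorialHankel (a m : ℕ) : Matrix (Fin m) (Fin m) ℝ :=
  Matrix.of fun p q => ((p + q + a : ℕ).factorial : ℝ)

/-- The Hankel matrix of the sequence `(k + 1)! * (H (k + 1) + C)` at `k = p + q + a`. -/
def harmonicHankel (a m : ℕ) (C : ℝ) : Matrix (Fin m) (Fin m) ℝ :=
  Matrix.of fun p q =>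
    ((p + q + a + 1 : ℕ).factorial : ℝ) * (harmonic (p + q + a + 1) + C)

theorem laguerreMatrix_mul_factorialHankel (a m : ℕ) (k q : Fin m) :
    (laguerreMatrix a m * factorialHankel a m) k q =
      ((q : ℕ).descFactorial k : ℝ) * (a + q).factorial / (a + k).factorial := by
  rw [← fwdDiff_iter_factorial_div, ← sum_fin_choose_eq_fwdDiff, Matrix.mul_apply]
  refine Finset.sum_congr rfl fun j _ => ?_
  simp only [laguerreMatrix, factorialHankel, Matrix.of_apply]
  rw [show (j + q + a : ℕ) = a + j + q by ring]
  ring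

theorem laguerreMatrix_mul_harmonicHankel (a m : ℕ) (C : ℝ) (k q : Fin m) :
    (laguerreMatrix a m * harmonicHankel a m C) k q =
      ((descPochhammer ℝ k).derivative.eval ((q + 1 : ℕ) : ℝ) +
        (((q : ℕ) + 1).descFactorial k : ℝ) * (harmonic (a + (q + 1)) + C)) *
          (a + (q + 1)).factorial / (a + k).factorial := by
  rw [← fwdDiff_iter_factorial_mul_harmonic_div, ← sum_fin_choose_eq_fwdDiff, Matrix.mul_apply]
  refine Finset.sum_congr rfl fun j _ => ?_
  simp only [laguerreMatrix, harmonicHankel, Matrix.of_apply]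
  rw [show (j + q + a + 1 : ℕ) = a + j + (q + 1) by ring]
  ring

theorem laguerreMatrix_congr_factorialHankel_apply_of_le (a m : ℕ) {k l : Fin m} (hkl : l ≤ k) :
    (laguerreMatrix a m * factorialHankel a m * (laguerreMatrix a m).transpose) k l =
      Matrix.diagonal (fun k : Fin m => ((k : ℕ).factorial : ℝ) / (a + k).factorial) k l := by
  rw [Matrix.mul_apply, Finset.sum_eq_single k]
  · rw [laguerreMatrix_mul_factorialHankel, Nat.descFactorial_self]
    simp only [laguerreMatrix, Matrix.transpose_apply, Matrix.of_apply]
    rcases hkl.lt_or_eq with h | rfl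
    · rw [Nat.choose_eq_zero_of_lt (by exact h), Matrix.diagonal_apply_ne _ h.ne']
      simp
    · have := Nat.factorial_ne_zero (a + l)
      simp
      field_simp
  · intro q _ hq
    rw [laguerreMatrix_mul_factorialHankel]
    simp only [laguerreMatrix, Matrix.transpose_apply, Matrix.of_apply]
    rcases lt_or_gt_of_ne hq with h | h
    · rw [Nat.descFactorial_of_lt (by exact h)]
      simp
    · rw [Nat.choose_eq_zero_of_lt (by exact hkl.trans_lt h)]
      simp
  · simp

theorem laguerreMatrix_congr_factorialHankel (a m : ℕ) :
    laguerreMatrix a m * factorialHankel a m * (laguerreMatrix a m).transpose =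
      Matrix.diagonal fun k : Fin m => ((k : ℕ).factorial : ℝ) / (a + k).factorial := by
  ext k l
  rcases le_total l k with h | h
  · exact laguerreMatrix_congr_factorialHankel_apply_of_le a m h
  · have hs : (factorialHankel a m).transpose = factorialHankel a m := by
      ext p q
      simp [factorialHankel, add_comm (p : ℕ)]
    have ht : (laguerreMatrix a m * factorialHankel a m * (laguerreMatrix a m).transpose).transpose =
        laguerreMatrix a m * factorialHankel a m * (laguerreMatrix a m).transpose := by
      simp only [Matrix.transpose_mul, hs, Matrix.transpose_transpose, Matrix.mul_assoc]
    rw [← ht, Matrix.transpose_apply, laguerreMatrix_congr_factorialHankel_apply_of_le a m h,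
      ← Matrix.transpose_apply (Matrix.diagonal _), Matrix.diagonal_transpose]

theorem laguerreMatrix_congr_harmonicHankel_apply_self (a m : ℕ) (C : ℝ) (k : Fin m) :
    (laguerreMatrix a m * harmonicHankel a m C * (laguerreMatrix a m).transpose) k k =
      ((k : ℕ).factorial : ℝ) / (a + k).factorial *
        ((2 * k + a + 1) * (harmonic (k + a) + C) + 2 * k + 1) := by
  rw [mul_comm_div, mul_div_assoc', ← sum_choose_mul_derivative_descPochhammer,
    ← sum_fin_choose_eq_sum_range k fun q => ((q + a + 1 : ℝ) *
      ((descPochhammer ℝ k).derivative.eval ((q + 1 : ℕ) : ℝ) +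
        ((q + 1).descFactorial k : ℝ) * (harmonic (a + (q + 1)) + C))),
    Finset.sum_div, Matrix.mul_apply]
  refine Finset.sum_congr rfl fun q _ => ?_
  rw [laguerreMatrix_mul_harmonicHankel]
  simp only [laguerreMatrix, Matrix.transpose_apply, Matrix.of_apply]
  rw [← add_assoc, Nat.factorial_succ (a + q)]
  have := Nat.factorial_ne_zero (a + q)
  push_cast
  field_simp
  ring

theorem sum_range_mul_harmonic (a m : ℕ) (C : ℝ) :
    ∑ k ∈ Finset.range m, ((2 * k + a + 1) * ((harmonic (k + a) : ℝ) + C) + 2 * k + 1) =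
      m * (m + a) * (harmonic (m + a) + C) + m * (m - 1) / 2 := by
  induction m with
  | zero => simp
  | succ m ih =>
    rw [Finset.sum_range_succ, ih, show m + 1 + a = m + a + 1 by ring, harmonic_succ]
    have h : ((m : ℝ) + a + 1) ≠ 0 := by positivity
    push_cast
    field_simp
    ring

theorem det_factorialHankel_ne_zero_and_trace (a m : ℕ) (C : ℝ) :
    (factorialHankel a m).det ≠ 0 ∧
    (harmonicHankel a m C * (factorialHankel a m).adjugate).trace = (factorialHankel a m).det *
      (m * (m + a) * (harmonic (m + a) + C) + m * (m - 1) / 2) := by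
  have hne (k : Fin m) : ((k : ℕ).factorial : ℝ) / (a + k).factorial ≠ 0 := by positivity
  obtain ⟨h1, h2⟩ := trace_mul_adjugate_of_congr_diagonal _ (harmonicHankel a m C) _ _ hne
    (laguerreMatrix_congr_factorialHankel a m)
  refine ⟨h1, ?_⟩
  rw [h2, ← sum_range_mul_harmonic, ← Fin.sum_univ_eq_sum_range
    (fun k => ((2 * k + a + 1) * ((harmonic (k + a) : ℝ) + C) + 2 * k + 1)) m]
  congr 1
  refine Finset.sum_congr rfl fun k _ => ?_
  rw [laguerreMatrix_congr_harmonicHankel_apply_self, mul_div_cancel_left₀ _ (hne k)]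

/-- A sequence of continuous functions in which every `φ (k + 1)` is the primitive of `φ k`
on the half-line that vanishes at `0`. -/
structure IsPrimitiveSeq (φ : ℕ → ℝ → ℝ) : Prop where
  continuous (k : ℕ) : Continuous (φ k)
  zero (k : ℕ) : φ (k + 1) 0 = 0
  hasDerivAt (k : ℕ) {x : ℝ} (hx : 0 < x) : HasDerivAt (φ (k + 1)) (φ k x) x

theorem hasDerivAt_pow_succ_div_factorial (k : ℕ) (x : ℝ) :
    HasDerivAt (fun x : ℝ => x ^ (k + 1) / (k + 1).factorial) (x ^ k / k.factorial) x := by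
  refine ((hasDerivAt_pow (k + 1) x).div_const ((k + 1).factorial : ℝ)).congr_deriv ?_
  rw [Nat.factorial_succ]
  have := Nat.factorial_ne_zero k
  simp
  field_simp

theorem isPrimitiveSeq_pow_div_factorial :
    IsPrimitiveSeq fun k x => x ^ k / k.factorial where
  continuous k := by fun_prop
  zero k := by simp
  hasDerivAt k x _ := hasDerivAt_pow_succ_div_factorial k x

theorem isPrimitiveSeq_pow_mul_log (c : ℝ) :
    IsPrimitiveSeq fun k x =>
      x ^ (k + 1) * (Real.log x - harmonic (k + 1) + c) / (k + 1).factorial where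
  continuous k := by
    have h : (fun x : ℝ => x ^ (k + 1) * (Real.log x - harmonic (k + 1) + c) / (k + 1).factorial) =
        fun x => (x ^ k * (x * Real.log x) + x ^ (k + 1) * (c - harmonic (k + 1))) /
          (k + 1).factorial := by
      ext x; ring
    rw [h]
    have := Real.continuous_mul_log
    fun_prop
  zero k := by simp
  hasDerivAt k x hx := by
    have h1 := hasDerivAt_pow_succ_div_factorial (k + 1) x
    have h2 := ((Real.hasDerivAt_log hx.ne').sub_const (harmonic (k + 1 + 1) : ℝ)).add_const c
    simp only [mul_div_right_comm]
    refine (h1.mul h2).congr_deriv ?_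
    rw [harmonic_succ (k + 1), Nat.factorial_succ (k + 1)]
    have h0 := hx.ne'
    have := Nat.factorial_ne_zero (k + 1)
    push_cast
    field_simp
    ring

theorem IsPrimitiveSeq.integral_mul_pow {φ : ℕ → ℝ → ℝ} (hφ : IsPrimitiveSeq φ) (k l : ℕ)
    {r : ℝ} (hr : 0 ≤ r) :
    ∫ x in (0 : ℝ)..r, φ k x * ((r - x) ^ l / l.factorial) = φ (k + l + 1) r := by
  induction l generalizing k with
  | zero =>
    simp only [pow_zero, Nat.factorial_zero, Nat.cast_one, div_one, mul_one, add_zero]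
    rw [intervalIntegral.integral_eq_sub_of_hasDerivAt_of_le hr (hφ.continuous (k + 1)).continuousOn
      (fun x hx => hφ.hasDerivAt k hx.1) ((hφ.continuous k).intervalIntegrable _ _), hφ.zero,
      sub_zero]
  | succ l ih =>
    have hv (x : ℝ) : HasDerivAt (fun x : ℝ => (r - x) ^ (l + 1) / (l + 1).factorial)
        (-((r - x) ^ l / l.factorial)) x := by
      exact ((hasDerivAt_pow_succ_div_factorial l (r - x)).comp x
        ((hasDerivAt_id x).const_sub r)).congr_deriv (by ring)
    have hparts := intervalIntegral.integral_mul_deriv_eq_deriv_mul_of_hasDerivAt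
      (a := 0) (b := r) (u := fun x : ℝ => (r - x) ^ (l + 1) / (l + 1).factorial)
      (v := φ (k + 1)) (u' := fun x => -((r - x) ^ l / l.factorial)) (v' := φ k)
      (by fun_prop) (hφ.continuous _).continuousOn (fun x _ => hv x)
      (fun x hx => hφ.hasDerivAt k (by simpa [hr] using hx.1))
      (Continuous.intervalIntegrable (by fun_prop) _ _)
      ((hφ.continuous k).intervalIntegrable _ _)
    have hih := ih (k + 1)
    rw [show k + 1 + l + 1 = k + (l + 1) + 1 by ring] at hih
    rw [← hih]
    simp only [hφ.zero, sub_self, neg_mul, intervalIntegral.integral_neg] at hparts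
    simp only [mul_comm (φ _ _)]
    rw [hparts]
    simp

/-- The corner simplex of size `r` in `ℝ ^ d`. -/
def cornerSimplex (d : ℕ) (r : ℝ) : Set (Fin d → ℝ) :=
  {q | (∀ j, 0 ≤ q j) ∧ ∑ j, q j ≤ r}

theorem isCompact_cornerSimplex (d : ℕ) (r : ℝ) : IsCompact (cornerSimplex d r) := by
  refine (isCompact_Icc (a := (0 : Fin d → ℝ)) (b := fun _ => r)).of_isClosed_subset ?_ ?_
  · have h : cornerSimplex d r = (⋂ j, {q | 0 ≤ q j}) ∩ {q | ∑ j, q j ≤ r} := by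
      ext q; simp [cornerSimplex]
    rw [h]
    exact (isClosed_iInter fun j => isClosed_le continuous_const (continuous_apply j)).inter
      (isClosed_le (by fun_prop) continuous_const)
  · intro q hq
    refine ⟨hq.1, fun j => ?_⟩
    exact (Finset.single_le_sum (fun i _ => hq.1 i) (Finset.mem_univ j)).trans hq.2

theorem cornerSimplex_eq_empty {d : ℕ} {r : ℝ} (hr : r < 0) : cornerSimplex d r = ∅ := by
  ext q
  simp only [Set.mem_empty_iff_false, iff_false]
  intro hq
  exact absurd ((Finset.sum_nonneg fun i _ => hq.1 i).trans hq.2) (not_le.2 hr)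

theorem cons_mem_cornerSimplex {d : ℕ} {r x : ℝ} {p : Fin d → ℝ} :
    (Fin.cons x p : Fin (d + 1) → ℝ) ∈ cornerSimplex (d + 1) r ↔
      0 ≤ x ∧ p ∈ cornerSimplex d (r - x) := by
  simp only [cornerSimplex, Set.mem_ofPred_eq, Fin.forall_fin_succ, Fin.cons_zero, Fin.cons_succ,
    Fin.sum_univ_succ, and_assoc]
  rw [le_sub_iff_add_le']

/-- The iterated convolution of `f 0, …, f d` on the half-line, at `r`. -/
def simplexConv (d : ℕ) (f : Fin (d + 1) → ℝ → ℝ) (r : ℝ) : ℝ :=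
  ∫ q in cornerSimplex d r, (∏ j : Fin d, f j.castSucc (q j)) * f (Fin.last d) (r - ∑ j, q j)

theorem simplexConv_zero (f : Fin 1 → ℝ → ℝ) {r : ℝ} (hr : 0 ≤ r) :
    simplexConv 0 f r = f 0 r := by
  have h : cornerSimplex 0 r = Set.univ := by
    ext q; simp [cornerSimplex, hr]
  simp only [simplexConv, h, Measure.restrict_univ, Finset.univ_eq_empty, Finset.prod_empty,
    Finset.sum_empty, sub_zero, one_mul, integral_const]
  simp [measureReal_def, volume_pi]

theorem simplexConv_succ {d : ℕ} (f : Fin (d + 2) → ℝ → ℝ) (hf : ∀ j, Continuous (f j))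
    {r : ℝ} (hr : 0 ≤ r) :
    simplexConv (d + 1) f r =
      ∫ x in (0 : ℝ)..r, f 0 x * simplexConv d (fun j => f j.succ) (r - x) := by
  set F : (Fin (d + 1) → ℝ) → ℝ := fun q =>
    (∏ j : Fin (d + 1), f j.castSucc (q j)) * f (Fin.last (d + 1)) (r - ∑ j, q j) with hF
  have hFc : Continuous F := by fun_prop
  have hmeas := (isCompact_cornerSimplex (d + 1) r).measurableSet
  have hint : Integrable ((cornerSimplex (d + 1) r).indicator F) :=
    (integrable_indicator_iff hmeas).2
      (hFc.continuousOn.integrableOn_compact (isCompact_cornerSimplex _ _))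
  let e := MeasurableEquiv.piFinSuccAbove (fun _ : Fin (d + 1) => ℝ) 0
  have he : MeasurePreserving e.symm :=
    (volume_preserving_piFinSuccAbove (fun _ : Fin (d + 1) => ℝ) 0).symm e
  have hes (x : ℝ) (p : Fin d → ℝ) : e.symm (x, p) = (Fin.cons x p : Fin (d + 1) → ℝ) := by
    simp [e, MeasurableEquiv.piFinSuccAbove]
    rfl
  have hinner (x : ℝ) : ∫ p, (cornerSimplex (d + 1) r).indicator F (e.symm (x, p)) =
      (Set.Icc 0 r).indicator
        (fun x => f 0 x * simplexConv d (fun j => f j.succ) (r - x)) x := by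
    have hpt (p : Fin d → ℝ) (hx : 0 ≤ x) :
        (cornerSimplex (d + 1) r).indicator F (e.symm (x, p)) =
        (cornerSimplex d (r - x)).indicator (fun p => f 0 x *
          ((∏ j : Fin d, f j.castSucc.succ (p j)) * f (Fin.last d).succ (r - x - ∑ j, p j))) p := by
      rw [hes]
      by_cases hp : p ∈ cornerSimplex d (r - x)
      · rw [Set.indicator_of_mem hp, Set.indicator_of_mem (cons_mem_cornerSimplex.2 ⟨hx, hp⟩)]
        simp only [hF, Fin.prod_univ_succ, Fin.sum_univ_succ, Fin.cons_zero, Fin.cons_succ,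
          mul_assoc, sub_sub]
        rfl
      · rw [Set.indicator_of_notMem hp,
          Set.indicator_of_notMem fun h => hp (cons_mem_cornerSimplex.1 h).2]
    by_cases hx : 0 ≤ x
    · simp only [hpt _ hx]
      rw [integral_indicator (isCompact_cornerSimplex _ _).measurableSet, integral_const_mul]
      by_cases hxr : x ≤ r
      · rw [Set.indicator_of_mem (Set.mem_Icc.2 ⟨hx, hxr⟩)]
        rfl
      · rw [Set.indicator_of_notMem (fun h => hxr h.2), cornerSimplex_eq_empty (by linarith)]
        simp
    · rw [Set.indicator_of_notMem (fun h => hx h.1)]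
      refine (integral_congr_ae (Filter.Eventually.of_forall fun p => ?_)).trans (integral_zero _ _)
      rw [hes]
      exact Set.indicator_of_notMem (fun h => hx (cons_mem_cornerSimplex.1 h).1) _
  calc simplexConv (d + 1) f r = ∫ q, (cornerSimplex (d + 1) r).indicator F q :=
        (integral_indicator hmeas).symm
    _ = ∫ z, (cornerSimplex (d + 1) r).indicator F (e.symm z) :=
        (he.integral_comp e.symm.measurableEmbedding _).symm
    _ = ∫ x, ∫ p, (cornerSimplex (d + 1) r).indicator F (e.symm (x, p)) :=
        integral_prod _ (he.integrable_comp_of_integrable hint)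
    _ = _ := by
        simp only [hinner]
        rw [integral_indicator measurableSet_Icc, integral_Icc_eq_integral_Ioc,
          intervalIntegral.integral_of_le hr]

theorem IsPrimitiveSeq.simplexConv_eq {φ : ℕ → ℝ → ℝ} (hφ : IsPrimitiveSeq φ) {d : ℕ}
    (i : Fin (d + 1)) (k : Fin (d + 1) → ℕ) {r : ℝ} (hr : 0 ≤ r) :
    simplexConv d (fun j x => if j = i then φ (k j) x else x ^ k j / (k j).factorial) r =
      φ (∑ j, k j + d) r := by
  induction d generalizing φ r with
  | zero =>
    obtain rfl : i = 0 := Fin.ext (by omega)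
    rw [simplexConv_zero _ hr]
    simp
  | succ d ih =>
    rw [simplexConv_succ _ _ hr]
    · rcases Fin.eq_zero_or_eq_succ i with rfl | ⟨i, rfl⟩
      · rw [Fin.sum_univ_succ, ← add_assoc, add_assoc (k 0), ← hφ.integral_mul_pow _ _ hr]
        refine intervalIntegral.integral_congr fun x hx => ?_
        rw [Set.uIcc_of_le hr] at hx
        have := ih isPrimitiveSeq_pow_div_factorial 0 (fun j => k j.succ)
          (sub_nonneg.2 hx.2)
        simp only [ite_self] at this
        simp [this, Fin.succ_ne_zero]
      · rw [Fin.sum_univ_succ, ← add_assoc, add_assoc (k 0), add_comm (k 0),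
          ← hφ.integral_mul_pow _ _ hr]
        have hrev := intervalIntegral.integral_comp_sub_left (a := 0) (b := r)
          (fun x => φ (∑ j : Fin (d + 1), k j.succ + d) x * ((r - x) ^ k 0 / (k 0).factorial)) r
        rw [sub_self, sub_zero] at hrev
        rw [← hrev]
        refine intervalIntegral.integral_congr fun x hx => ?_
        rw [Set.uIcc_of_le hr] at hx
        have := ih hφ i (fun j => k j.succ) (sub_nonneg.2 hx.2)
        simp only [Fin.succ_inj, (Fin.succ_ne_zero i).symm, if_false, this, sub_sub_cancel]
        ring
    · intro j
      split_ifs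
      · exact hφ.continuous _
      · fun_prop

theorem simplexExt_castSucc (d : ℕ) (q : Fin d → ℝ) (j : Fin d) :
    simplexExt (d + 1) q j.castSucc = q j := by
  simp [simplexExt]

theorem simplexExt_last (d : ℕ) (q : Fin d → ℝ) :
    simplexExt (d + 1) q (Fin.last d) = 1 - ∑ j, q j := by
  simp [simplexExt]

theorem continuous_simplexExt_apply (m : ℕ) (j : Fin m) :
    Continuous fun q => simplexExt m q j := by
  unfold simplexExt
  split_ifs <;> fun_prop

theorem integrableOn_simplexDom {m : ℕ} {g : (Fin (m - 1) → ℝ) → ℝ} (hg : Continuous g) :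
    IntegrableOn g (simplexDom m) :=
  hg.continuousOn.integrableOn_compact (isCompact_cornerSimplex (m - 1) 1)

theorem integral_simplexDom_prod (d : ℕ) (f : Fin (d + 1) → ℝ → ℝ) :
    ∫ q in simplexDom (d + 1), ∏ j, f j (simplexExt (d + 1) q j) = simplexConv d f 1 := by
  refine integral_congr_ae (Filter.Eventually.of_forall fun q => ?_)
  simp only [Fin.prod_univ_castSucc]
  exact congrArg₂ _ (Finset.prod_congr rfl fun j _ => congrArg _ (simplexExt_castSucc d q j))
    (congrArg _ (simplexExt_last d q))

theorem IsPrimitiveSeq.integral_simplexDom {φ : ℕ → ℝ → ℝ} (hφ : IsPrimitiveSeq φ) (d : ℕ)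
    (i : Fin (d + 1)) (k : Fin (d + 1) → ℕ) :
    ∫ q in simplexDom (d + 1), ∏ j, (if j = i then (k i).factorial * φ (k i) (simplexExt (d + 1) q i)
        else simplexExt (d + 1) q j ^ k j) =
      (∏ j, ((k j).factorial : ℝ)) * φ (∑ j, k j + d) 1 := by
  rw [← hφ.simplexConv_eq i k zero_le_one, ← integral_simplexDom_prod, ← integral_const_mul]
  refine integral_congr_ae (Filter.Eventually.of_forall fun q => ?_)
  simp only [← Finset.prod_mul_distrib]
  refine Finset.prod_congr rfl fun j _ => ?_
  split_ifs with h
  · rw [h]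
  · field_simp

theorem integral_simplexDom_prod_pow (d : ℕ) (k : Fin (d + 1) → ℕ) :
    ∫ q in simplexDom (d + 1), ∏ j, simplexExt (d + 1) q j ^ k j =
      (∏ j, ((k j).factorial : ℝ)) / (∑ j, k j + d).factorial := by
  have h := isPrimitiveSeq_pow_div_factorial.integral_simplexDom d 0 k
  simp only [one_pow, mul_one_div] at h
  rw [← h]
  refine integral_congr_ae (Filter.Eventually.of_forall fun q => ?_)
  refine Finset.prod_congr rfl fun j _ => ?_
  split_ifs with h
  · rw [h]; field_simp
  · rfl

theorem integral_simplexDom_mul_log_mul_prod_pow (d : ℕ) (i : Fin (d + 1)) (k : Fin (d + 1) → ℕ) :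
    ∫ q in simplexDom (d + 1), simplexExt (d + 1) q i * Real.log (simplexExt (d + 1) q i) *
        ∏ j, simplexExt (d + 1) q j ^ k j =
      (∏ j, (if j = i then ((k j + 1).factorial : ℝ) *
          (harmonic (k j + 1) + -harmonic (∑ j, k j + d + 1)) else ((k j).factorial : ℝ))) /
        (∑ j, k j + d + 1).factorial := by
  have h := (isPrimitiveSeq_pow_mul_log (harmonic (k i + 1))).integral_simplexDom d i k
  have hL : ∫ q in simplexDom (d + 1), simplexExt (d + 1) q i *
      Real.log (simplexExt (d + 1) q i) * ∏ j, simplexExt (d + 1) q j ^ k j = (k i + 1 : ℝ) *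
      ∫ q in simplexDom (d + 1), ∏ j, (if j = i then (k i).factorial *
        (simplexExt (d + 1) q i ^ (k i + 1) * (Real.log (simplexExt (d + 1) q i) -
          harmonic (k i + 1) + harmonic (k i + 1)) / (k i + 1).factorial)
        else simplexExt (d + 1) q j ^ k j) := by
    rw [← integral_const_mul]
    refine integral_congr_ae (Filter.Eventually.of_forall fun q => ?_)
    simp only [← Finset.mul_prod_erase _ _ (Finset.mem_univ i), if_true]
    rw [Finset.prod_congr rfl fun j hj => if_neg (Finset.ne_of_mem_erase hj), Nat.factorial_succ]
    have := Nat.factorial_ne_zero (k i)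
    push_cast
    field_simp
    ring
  rw [hL, h]
  simp only [← Finset.mul_prod_erase _ _ (Finset.mem_univ i), if_true]
  rw [Finset.prod_congr rfl fun j hj => if_neg (Finset.ne_of_mem_erase hj),
    Nat.factorial_succ (k i), one_pow, Real.log_one]
  push_cast
  ring

theorem vandermonde_sq_mul_prod_pow {m : ℕ} (a : ℕ) (x : Fin m → ℝ) :
    (∏ j, ∏ k ∈ Finset.Ioi j, (x k - x j) ^ 2) * ∏ j, x j ^ a =
      ∑ σ : Equiv.Perm (Fin m), ∑ τ : Equiv.Perm (Fin m),
        ((σ.sign : ℤ) : ℝ) * ((τ.sign : ℤ) : ℝ) * ∏ j, x j ^ ((σ j : ℕ) + τ j + a) := by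
  have h : (∏ j, ∏ k ∈ Finset.Ioi j, (x k - x j) ^ 2) =
      (∑ σ : Equiv.Perm (Fin m), ((σ.sign : ℤ) : ℝ) * ∏ j, x j ^ (σ j : ℕ)) *
        ∑ σ : Equiv.Perm (Fin m), ((σ.sign : ℤ) : ℝ) * ∏ j, x j ^ (σ j : ℕ) := by
    have hV := Matrix.det_vandermonde x
    rw [← Matrix.det_transpose, Matrix.det_apply'] at hV
    simp only [Matrix.transpose_apply, Matrix.vandermonde_apply] at hV
    rw [hV]
    simp only [Finset.prod_pow, ← sq]
  rw [h, Finset.sum_mul_sum, Finset.sum_mul]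
  refine Finset.sum_congr rfl fun σ _ => ?_
  rw [Finset.sum_mul]
  refine Finset.sum_congr rfl fun τ _ => ?_
  simp only [pow_add, Finset.prod_mul_distrib]
  ring

theorem sum_perm_add_perm_add (d a : ℕ) (σ τ : Equiv.Perm (Fin (d + 1))) :
    ∑ j, ((σ j : ℕ) + τ j + a) + d + 1 = (d + 1) * (d + 1 + a) := by
  rw [Finset.sum_add_distrib, Finset.sum_add_distrib,
    Equiv.sum_comp σ fun j => (j : ℕ), Equiv.sum_comp τ fun j => (j : ℕ),
    Fin.sum_univ_eq_sum_range fun j => j]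
  have h := Finset.sum_range_id_mul_two (d + 1)
  simp only [Finset.sum_const, Finset.card_univ, Fintype.card_fin, smul_eq_mul]
  rw [Nat.add_sub_cancel] at h
  linarith

theorem integral_simplexDom_vandermonde_sq (d a : ℕ) :
    ∫ q in simplexDom (d + 1),
        (∏ j, ∏ k ∈ Finset.Ioi j, (simplexExt (d + 1) q k - simplexExt (d + 1) q j) ^ 2) *
          ∏ j, simplexExt (d + 1) q j ^ a =
      (d + 1).factorial * (factorialHankel a (d + 1)).det /
        ((d + 1) * (d + 1 + a) - 1).factorial := by
  have hc := continuous_simplexExt_apply (d + 1)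
  simp only [vandermonde_sq_mul_prod_pow]
  rw [integral_finsetSum _ fun σ _ => integrableOn_simplexDom (by fun_prop),
    ← sum_perm_sum_perm, Finset.sum_div]
  refine Finset.sum_congr rfl fun σ _ => ?_
  rw [integral_finsetSum _ fun τ _ => integrableOn_simplexDom (by fun_prop), Finset.sum_div]
  refine Finset.sum_congr rfl fun τ _ => ?_
  rw [integral_const_mul, integral_simplexDom_prod_pow, mul_div_assoc,
    ← sum_perm_add_perm_add d a σ τ, Nat.add_sub_cancel]
  rfl

theorem integral_simplexDom_entropy_mul_vandermonde_sq (d a : ℕ) :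
    ∫ q in simplexDom (d + 1),
        (-∑ j, simplexExt (d + 1) q j * Real.log (simplexExt (d + 1) q j)) *
          ((∏ j, ∏ k ∈ Finset.Ioi j, (simplexExt (d + 1) q k - simplexExt (d + 1) q j) ^ 2) *
            ∏ j, simplexExt (d + 1) q j ^ a) =
      -((d + 1).factorial * (harmonicHankel a (d + 1) (-harmonic ((d + 1) * (d + 1 + a))) *
        (factorialHankel a (d + 1)).adjugate).trace / ((d + 1) * (d + 1 + a)).factorial) := by
  have hc := continuous_simplexExt_apply (d + 1)
  have hl (j : Fin (d + 1)) :
      Continuous fun q => simplexExt (d + 1) q j * Real.log (simplexExt (d + 1) q j) :=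
    Real.continuous_mul_log.comp (hc j)
  simp only [vandermonde_sq_mul_prod_pow, neg_mul, integral_neg, neg_inj]
  simp only [Finset.sum_mul (s := Finset.univ (α := Fin (d + 1)))]
  simp only [Finset.mul_sum]
  rw [integral_finsetSum _ fun i _ => integrableOn_simplexDom (by fun_prop),
    ← sum_det_updateRow_eq_trace, ← sum_perm_sum_perm_updateRow, Finset.sum_div]
  refine Finset.sum_congr rfl fun i _ => ?_
  rw [integral_finsetSum _ fun σ _ => integrableOn_simplexDom (by fun_prop), Finset.sum_div]
  refine Finset.sum_congr rfl fun σ _ => ?_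
  rw [integral_finsetSum _ fun τ _ => integrableOn_simplexDom (by fun_prop), Finset.sum_div]
  refine Finset.sum_congr rfl fun τ _ => ?_
  simp only [mul_left_comm _ (((σ.sign : ℤ) : ℝ) * ((τ.sign : ℤ) : ℝ))]
  rw [integral_const_mul, integral_simplexDom_mul_log_mul_prod_pow, mul_div_assoc,
    sum_perm_add_perm_add]
  rfl

theorem harmonic_sub_harmonic_eq_sum_Icc {n N : ℕ} (h : n ≤ N) :
    (harmonic N : ℝ) - harmonic n = ∑ k ∈ Finset.Icc (n + 1) N, (1 : ℝ) / k := by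
  induction N, h using Nat.le_induction with
  | base => simp
  | succ N hN ih =>
    rw [Finset.sum_Icc_succ_top (by omega), ← ih, harmonic_succ]
    push_cast
    ring

/-- For `1 ≤ m ≤ n`, the ratio over the probability simplex
`F_m` of the integral of the Shannon entropy `−∑ q_j ln q_j` against the
density `∏_{j<k}(q_k−q_j)² ∏_j q_j^{n−m}` to the integral of the density
itself equals `∑_{k=n+1}^{mn} 1/k − (m−1)/(2n)`. -/
theorem simplex_entropy_ratio (m n : ℕ) (hm : 1 ≤ m) (hmn : m ≤ n) :
    (∫ q in simplexDom m,
        (-∑ j, simplexExt m q j * Real.log (simplexExt m q j)) *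
          ((∏ j, ∏ k ∈ Finset.Ioi j, (simplexExt m q k - simplexExt m q j) ^ 2) *
            ∏ j, simplexExt m q j ^ (n - m))) /
    (∫ q in simplexDom m,
        (∏ j, ∏ k ∈ Finset.Ioi j, (simplexExt m q k - simplexExt m q j) ^ 2) *
          ∏ j, simplexExt m q j ^ (n - m)) =
      (∑ k ∈ Finset.Icc (n + 1) (m * n), (1 : ℝ) / k) - ((m : ℝ) - 1) / (2 * n) := by
  obtain ⟨d, rfl⟩ : ∃ d, m = d + 1 := ⟨m - 1, by omega⟩
  obtain ⟨a, rfl⟩ : ∃ a, n = d + 1 + a := ⟨n - (d + 1), by omega⟩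
  rw [Nat.add_sub_cancel_left, integral_simplexDom_entropy_mul_vandermonde_sq,
    integral_simplexDom_vandermonde_sq,
    ← harmonic_sub_harmonic_eq_sum_Icc (Nat.le_mul_of_pos_left _ (by omega))]
  obtain ⟨hdet, htr⟩ := det_factorialHankel_ne_zero_and_trace a (d + 1)
    (-harmonic ((d + 1) * (d + 1 + a)))
  rw [htr]
  obtain ⟨N, hN⟩ : ∃ N, (d + 1) * (d + 1 + a) = N + 1 :=
    ⟨(d + 1) * (d + 1 + a) - 1, by have : 0 < (d + 1) * (d + 1 + a) := by positivity
                                   omega⟩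
  have hN' : ((d : ℝ) + 1) * (d + 1 + a) = N + 1 := by exact_mod_cast hN
  rw [hN, Nat.add_sub_cancel, Nat.factorial_succ N]
  have h1 := Nat.factorial_ne_zero N
  have h2 := Nat.factorial_ne_zero (d + 1)
  have h3 : ((d : ℝ) + 1 + a) ≠ 0 := by positivity
  push_cast
  rw [← hN']
  field_simp
  ring
end
end
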